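/- arXiv:1306.4283 — 7 statements merged into one kernel-verified Lean document; each statement's English description precedes it below -/
import Mathlib

section
/- Let n be a natural number with Euler's totient φ(n) > 24, and let S_n denote the set of positive integers x < n with gcd(x,n) = 1. Then ∑_{x ∈ S_n} min(x, n−x) > 2n. -/
/-- The terms of a sum over the fractions `x / n` with `0 ≤ x < n`, grouped by reduced denominator. -/
lemma sum_range_div_eq_sum_divisors (h : ℚ → ℚ) {n : ℕ} (hn : n ≠ 0) :
    ∑ x ∈ Finset.range n, h (x / n) =
      ∑ d ∈ n.divisors, ∑ y ∈ (Finset.range d).filter (fun y => Nat.Coprime y d), h (y / d) := by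
  have hpos : 0 < n := Nat.pos_of_ne_zero hn
  rw [← Finset.sum_fiberwise_of_maps_to (s := Finset.range n) (t := n.divisors)
    (g := fun x => n / Nat.gcd x n)
    (fun x _ => Nat.mem_divisors.2 ⟨Nat.div_dvd_of_dvd (Nat.gcd_dvd_right x n), hn⟩)]
  refine Finset.sum_congr rfl fun d hd => ?_
  obtain ⟨e, rfl⟩ := Nat.dvd_of_mem_divisors hd
  have hd0 : 0 < d := Nat.pos_of_mul_pos_right hpos
  have he0 : 0 < e := Nat.pos_of_mul_pos_left hpos
  symm
  refine Finset.sum_bij (fun y _ => y * e) ?_ ?_ ?_ ?_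
  · intro y hy
    simp only [Finset.mem_filter, Finset.mem_range] at hy ⊢
    refine ⟨Nat.mul_lt_mul_of_pos_right hy.1 he0, ?_⟩
    rw [Nat.gcd_mul_right, hy.2.gcd_eq_one, one_mul, Nat.mul_div_cancel _ he0]
  · intro y _ z _ hyz
    exact Nat.eq_of_mul_eq_mul_right he0 hyz
  · intro x hx
    simp only [Finset.mem_filter, Finset.mem_range] at hx
    obtain ⟨hx1, hx2⟩ := hx
    have hg : Nat.gcd x (d * e) = e := by
      have h1 := Nat.div_mul_cancel (Nat.gcd_dvd_right x (d * e))
      rw [hx2] at h1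
      exact Nat.eq_of_mul_eq_mul_left hd0 h1
    obtain ⟨y, rfl⟩ : e ∣ x := by
      have := Nat.gcd_dvd_left x (d * e)
      rwa [hg] at this
    rw [mul_comm e y] at *
    refine ⟨y, ?_, rfl⟩
    simp only [Finset.mem_filter, Finset.mem_range]
    refine ⟨Nat.lt_of_mul_lt_mul_right hx1, ?_⟩
    rw [Nat.gcd_mul_right] at hg
    exact Nat.eq_of_mul_eq_mul_right he0 (by rw [hg, one_mul])
  · intro y _
    have : (e : ℚ) ≠ 0 := by exact_mod_cast he0.ne'
    push_cast
    rw [mul_div_mul_right _ _ this]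

lemma sum_range_div_mul_one_sub_div {n : ℕ} (hn : n ≠ 0) :
    ∑ x ∈ Finset.range n, ((x : ℚ) / n) * (1 - x / n) = (n - 1 / n) / 6 := by
  have key (c : ℚ) (m : ℕ) : ∑ x ∈ Finset.range m, ((x : ℚ) / c) * (1 - x / c) =
      m * (m - 1) / 2 / c - m * (m - 1) * (2 * m - 1) / 6 / c ^ 2 := by
    induction m with
    | zero => simp
    | succ k ih => rw [Finset.sum_range_succ, ih]; push_cast; ring
  have : (n : ℚ) ≠ 0 := by exact_mod_cast hn
  rw [key]
  field_simp
  ring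

/-- The reciprocal `n ↦ 1 / n` as an arithmetic function. -/
def reciprocal : ArithmeticFunction ℚ := ⟨fun n => 1 / n, by simp⟩

lemma reciprocal_apply (n : ℕ) : reciprocal n = 1 / n := rfl

lemma isMultiplicative_reciprocal : reciprocal.IsMultiplicative := by
  refine ⟨by simp [reciprocal_apply], fun {m n} _ => ?_⟩
  simp only [reciprocal_apply]
  push_cast
  rw [one_div_mul_one_div]

open ArithmeticFunction in
lemma abs_le_one_of_sum_divisors_eq_one_div (E : ℕ → ℚ)
    (hE : ∀ n : ℕ, n ≠ 0 → ∑ d ∈ n.divisors, E d = 1 / n) {n : ℕ} (hn : n ≠ 0) : |E n| ≤ 1 := by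
  have hconv : ∀ m : ℕ, m ≠ 0 → E m = ((moebius : ArithmeticFunction ℚ) * reciprocal) m := by
    intro m hm
    have := (sum_eq_iff_sum_mul_moebius_eq (f := E) (g := fun n => (1 / n : ℚ))).1
      (fun k hk => hE k hk.ne') m (Nat.pos_of_ne_zero hm)
    rw [← this, mul_apply]
    rfl
  have hmul : ((moebius : ArithmeticFunction ℚ) * reciprocal).IsMultiplicative :=
    isMultiplicative_moebius.intCast.mul isMultiplicative_reciprocal
  induction n using Nat.recOnPosPrimePosCoprime with
  | prime_pow p k hp hk =>
    obtain ⟨j, rfl⟩ := Nat.exists_eq_succ_of_ne_zero hk.ne'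
    have h1 := hE (p ^ (j + 1)) hn
    have h0 := hE (p ^ j) (pow_ne_zero _ hp.ne_zero)
    rw [Nat.sum_divisors_prime_pow hp] at h1 h0
    rw [Finset.sum_range_succ, h0] at h1
    have bound (i : ℕ) : 0 ≤ 1 / ((p ^ i : ℕ) : ℚ) ∧ 1 / ((p ^ i : ℕ) : ℚ) ≤ 1 := by
      have : (1 : ℚ) ≤ ((p ^ i : ℕ) : ℚ) := by exact_mod_cast Nat.one_le_pow _ _ hp.pos
      exact ⟨by positivity, (div_le_one (by linarith)).2 this⟩
    have b1 := bound (j + 1)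
    have b0 := bound j
    rw [abs_le]
    constructor <;> simp only [Nat.succ_eq_add_one] <;> linarith
  | zero => exact absurd rfl hn
  | one =>
    have := hE 1 one_ne_zero
    simp only [Nat.divisors_one, Finset.sum_singleton] at this
    simp [this]
  | coprime a b ha hb hab iha ihb =>
    rw [hconv _ hn, hmul.map_mul_of_coprime hab, ← hconv a (by omega), ← hconv b (by omega),
      abs_mul]
    exact mul_le_one₀ (iha (by omega)) (abs_nonneg _) (ihb (by omega))

lemma totient_sub_one_le_sum_coprime {n : ℕ} (hn : n ≠ 0) :
    (Nat.totient n - 1 : ℚ) ≤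
      6 * ∑ y ∈ (Finset.range n).filter (fun y => Nat.Coprime y n),
        ((y : ℚ) / n) * (1 - y / n) := by
  have := abs_le_one_of_sum_divisors_eq_one_div
    (fun n => (Nat.totient n : ℚ) - 6 * ∑ y ∈ (Finset.range n).filter (fun y => Nat.Coprime y n),
        ((y : ℚ) / n) * (1 - y / n)) (fun m hm => by
      rw [Finset.sum_sub_distrib, ← Finset.mul_sum,
        ← sum_range_div_eq_sum_divisors (fun t => t * (1 - t)) hm,
        sum_range_div_mul_one_sub_div hm, ← Nat.cast_sum, Nat.sum_totient]
      ring) hn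
  linarith [(abs_le.1 this).2]

lemma mul_div_mul_one_sub_div_le_min {x n : ℕ} (hx : x < n) :
    (n : ℚ) * ((x : ℚ) / n * (1 - x / n)) ≤ (min x (n - x) : ℕ) := by
  have hn : (0 : ℚ) < n := by exact_mod_cast (Nat.zero_le x).trans_lt hx
  have hxn : (x : ℚ) ≤ n := by exact_mod_cast hx.le
  have hx0 : (0 : ℚ) ≤ x := x.cast_nonneg
  have heq : (n : ℚ) * ((x : ℚ) / n * (1 - x / n)) = x * (n - x) / n := by
    field_simp
  rw [heq, Nat.cast_min, Nat.cast_sub hx.le, le_min_iff, div_le_iff₀ hn, div_le_iff₀ hn]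
  constructor <;> nlinarith

theorem totient_gt_24_sum_min_gt_two_mul
    (n : ℕ) (h : Nat.totient n > 24) :
    ∑ x ∈ (Finset.Ico 1 n).filter (fun x => Nat.Coprime x n), min x (n - x) > 2 * n := by
  have hn : n ≠ 0 := by
    rintro rfl
    simp at h
  have hn0 : (0 : ℚ) < n := by exact_mod_cast Nat.pos_of_ne_zero hn
  have hφ : (25 : ℚ) ≤ Nat.totient n := by exact_mod_cast h
  have hsum := totient_sub_one_le_sum_coprime hn
  have hIco : ∑ x ∈ (Finset.Ico 1 n).filter (fun x => Nat.Coprime x n), min x (n - x) =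
      ∑ x ∈ (Finset.range n).filter (fun x => Nat.Coprime x n), min x (n - x) := by
    refine Finset.sum_subset (fun x hx => ?_) fun x hx hx' => ?_
    · simp only [Finset.mem_filter, Finset.mem_Ico, Finset.mem_range] at hx ⊢
      exact ⟨hx.1.2, hx.2⟩
    · simp only [Finset.mem_filter, Finset.mem_Ico, Finset.mem_range] at hx hx'
      have : x = 0 := by
        by_contra h0
        exact hx' ⟨⟨Nat.pos_of_ne_zero h0, hx.1⟩, hx.2⟩
      simp [this]
  rw [hIco, gt_iff_lt, ← Nat.cast_lt (α := ℚ)]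
  have hle := Finset.sum_le_sum (s := (Finset.range n).filter (fun x => Nat.Coprime x n))
    fun x hx => mul_div_mul_one_sub_div_le_min (Finset.mem_range.1 (Finset.mem_filter.1 hx).1)
  rw [← Finset.mul_sum] at hle
  rw [Nat.cast_sum]
  refine lt_of_lt_of_le ?_ hle
  push_cast
  rw [mul_comm]
  exact mul_lt_mul_of_pos_left (by linarith) hn0
end

section
/- For every natural number n ≥ 2, 6·∑_{x ∈ S_n} x² = 2·φ(n)·n² + (−1)^{d_n}·φ(f(n))·n, where S_n is the set of positive integers x < n with gcd(x,n) = 1, d_n is the number of distinct prime divisors of n, and f(n) is the largest squarefree divisor of n (the product of the distinct prime divisors of n). -/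
open ArithmeticFunction in
theorem sum_divisors_moebius (n : ℕ) : ∑ d ∈ n.divisors, moebius d = if n = 1 then 1 else 0 := by
  rw [← coe_mul_zeta_apply, moebius_mul_coe_zeta, one_apply]

open ArithmeticFunction in
theorem sum_divisors_moebius_mul_div {n : ℕ} (hn : 0 < n) :
    ∑ d ∈ n.divisors, moebius d * (n / d : ℕ) = (n.totient : ℤ) := by
  have h := (sum_eq_iff_sum_mul_moebius_eq (f := fun m => (m.totient : ℤ))
    (g := fun m => (m : ℤ))).1 (fun m _ => by exact_mod_cast Nat.sum_totient m) n hn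
  simp only [Int.cast_id] at h
  rw [Nat.sum_divisorsAntidiagonal (fun d e => (moebius d : ℤ) * ((e : ℕ) : ℤ))] at h
  exact h

theorem totient_prod_primeFactors (n : ℕ) :
    (∏ p ∈ n.primeFactors, p).totient = ∏ p ∈ n.primeFactors, (p - 1) := by
  have hp : ∀ p ∈ n.primeFactors, p.Prime := fun p hp => Nat.prime_of_mem_primeFactors hp
  have h := Nat.totient_mul_prod_primeFactors (∏ p ∈ n.primeFactors, p)
  rw [Nat.primeFactors_prod hp, mul_comm] at h
  exact Nat.eq_of_mul_eq_mul_left (Finset.prod_pos fun p h => (hp p h).pos) h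

open ArithmeticFunction in
theorem sum_divisors_moebius_mul_self {n : ℕ} (hn : n ≠ 0) :
    ∑ d ∈ n.divisors, moebius d * (d : ℤ) = ∏ p ∈ n.primeFactors, (1 - (p : ℤ)) := by
  have hp : ∀ p ∈ n.primeFactors, p.Prime := fun p hp => Nat.prime_of_mem_primeFactors hp
  have hsq : Squarefree (∏ p ∈ n.primeFactors, p) :=
    Finset.squarefree_prod_of_pairwise_isCoprime
      (fun p h q h' hne => Nat.coprime_iff_isRelPrime.1
        ((Nat.coprime_primes (hp p h) (hp q h')).2 hne)) fun p h => (hp p h).squarefree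
  have h := IsMultiplicative.prodPrimeFactors_one_sub_of_squarefree
    (f := ((ArithmeticFunction.id : ArithmeticFunction ℕ) : ArithmeticFunction ℤ))
    isMultiplicative_id.natCast hsq
  rw [Nat.primeFactors_prod hp] at h
  simp only [natCoe_apply, id_apply, Int.cast_id] at h
  rw [h]
  symm
  refine Finset.sum_subset
    (Nat.divisors_subset_of_dvd hn (Nat.prod_primeFactors_dvd n)) fun d hd hd' => ?_
  rw [moebius_eq_zero_of_not_squarefree, zero_mul]
  refine fun hs => hd' (Nat.mem_divisors.2 ⟨?_, hsq.ne_zero⟩)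
  rw [← Nat.prod_primeFactors_of_squarefree hs]
  exact Finset.prod_dvd_prod_of_subset _ _ _
    (Nat.primeFactors_mono (Nat.dvd_of_mem_divisors hd) hn)

theorem six_mul_sum_Ioc_sq (m : ℕ) :
    (6 : ℤ) * ∑ y ∈ Finset.Ioc 0 m, (y : ℤ) ^ 2 = m * (m + 1) * (2 * m + 1) := by
  induction m with
  | zero => simp
  | succ m ih =>
    rw [Finset.sum_Ioc_succ_top (Nat.zero_le m), mul_add, ih]
    push_cast
    ring

theorem sum_Ioc_filter_dvd {M : Type*} [AddCommMonoid M] (f : ℕ → M) {d : ℕ} (hd : 0 < d) (n : ℕ) :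
    ∑ x ∈ (Finset.Ioc 0 n).filter (fun x => d ∣ x), f x =
      ∑ y ∈ Finset.Ioc 0 (n / d), f (d * y) := by
  symm
  refine Finset.sum_nbij (fun y => d * y) ?_ ?_ ?_ fun _ _ => rfl
  · intro y hy
    simp only [Finset.mem_Ioc, Finset.mem_filter] at hy ⊢
    exact ⟨⟨Nat.mul_pos hd hy.1, (Nat.mul_le_mul_left d hy.2).trans (Nat.mul_div_le n d)⟩,
      dvd_mul_right d y⟩
  · exact fun a _ b _ h => Nat.eq_of_mul_eq_mul_left hd h
  · rintro x hx
    simp only [Finset.coe_filter, Finset.mem_Ioc, Set.mem_ofPred_eq] at hx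
    obtain ⟨⟨h0, hxn⟩, y, rfl⟩ := hx
    refine ⟨y, ?_, rfl⟩
    simp only [Finset.coe_Ioc, Set.mem_Ioc]
    exact ⟨Nat.pos_of_mul_pos_left h0, (Nat.le_div_iff_mul_le hd).2 (by rwa [mul_comm])⟩

open ArithmeticFunction in
theorem sum_Ioc_filter_coprime (f : ℕ → ℤ) {n : ℕ} (hn : n ≠ 0) :
    ∑ x ∈ (Finset.Ioc 0 n).filter (fun x => Nat.Coprime x n), f x =
      ∑ d ∈ n.divisors, moebius d * ∑ y ∈ Finset.Ioc 0 (n / d), f (d * y) := by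
  have key : ∀ x, (if Nat.Coprime x n then f x else 0) =
      ∑ d ∈ n.divisors, if d ∣ x then moebius d * f x else 0 := by
    intro x
    rw [← Finset.sum_filter, ← Finset.sum_mul]
    have : n.divisors.filter (fun d => d ∣ x) = (Nat.gcd x n).divisors := by
      ext d
      simp [Nat.dvd_gcd_iff, hn, and_comm]
    rw [this, sum_divisors_moebius]
    simp [Nat.Coprime]
  rw [Finset.sum_filter, Finset.sum_congr rfl fun x _ => key x, Finset.sum_comm]
  refine Finset.sum_congr rfl fun d hd => ?_
  rw [← Finset.sum_filter, ← Finset.mul_sum,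
    sum_Ioc_filter_dvd f (Nat.pos_of_mem_divisors hd)]

theorem six_mul_sum_sq_coprime (n : ℕ) (hn : 2 ≤ n) :
    (6 : ℤ) * ∑ x ∈ (Finset.Ico 1 n).filter (fun x => Nat.Coprime x n), (x : ℤ) ^ 2 =
      2 * Nat.totient n * (n : ℤ) ^ 2 +
        (-1) ^ n.primeFactors.card * Nat.totient (∏ p ∈ n.primeFactors, p) * n := by
  have hn0 : n ≠ 0 := by omega
  have hIoc : (Finset.Ico 1 n).filter (fun x => Nat.Coprime x n) =
      (Finset.Ioc 0 n).filter (fun x => Nat.Coprime x n) := by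
    ext x
    simp only [Finset.mem_filter, Finset.mem_Ico, Finset.mem_Ioc]
    refine and_congr_left fun h => ?_
    have : x ≠ n := by
      rintro rfl
      rw [Nat.coprime_self] at h
      omega
    omega
  have hprod : (-1 : ℤ) ^ n.primeFactors.card * Nat.totient (∏ p ∈ n.primeFactors, p) =
      ∏ p ∈ n.primeFactors, (1 - (p : ℤ)) := by
    rw [totient_prod_primeFactors, ← Finset.prod_const, Nat.cast_prod, ← Finset.prod_mul_distrib]
    refine Finset.prod_congr rfl fun p hp => ?_
    rw [Nat.cast_sub (Nat.prime_of_mem_primeFactors hp).one_le]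
    push_cast
    ring
  have hterm : ∀ d ∈ n.divisors,
      6 * (ArithmeticFunction.moebius d * ∑ y ∈ Finset.Ioc 0 (n / d), ((d * y : ℕ) : ℤ) ^ 2) =
        2 * (n : ℤ) ^ 2 * (ArithmeticFunction.moebius d * (n / d : ℕ)) +
          3 * (n : ℤ) ^ 2 * ArithmeticFunction.moebius d +
          n * (ArithmeticFunction.moebius d * d) := by
    intro d hd
    have hnd : (n : ℤ) = d * (n / d : ℕ) := by
      exact_mod_cast (Nat.mul_div_cancel' (Nat.dvd_of_mem_divisors hd)).symm
    simp only [Nat.cast_mul, mul_pow, ← Finset.mul_sum]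
    generalize n / d = m at *
    rw [hnd]
    linear_combination ArithmeticFunction.moebius d * (d : ℤ) ^ 2 * six_mul_sum_Ioc_sq m
  rw [hIoc, sum_Ioc_filter_coprime (fun x => (x : ℤ) ^ 2) hn0, Finset.mul_sum,
    Finset.sum_congr rfl hterm, Finset.sum_add_distrib, Finset.sum_add_distrib,
    ← Finset.mul_sum, ← Finset.mul_sum, ← Finset.mul_sum,
    sum_divisors_moebius_mul_div (Nat.pos_of_ne_zero hn0), sum_divisors_moebius,
    sum_divisors_moebius_mul_self hn0, hprod, if_neg (by omega)]
  ring
end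

section
/- If f is a primitive type, then f(x) ≤ 1 for every rational x; that is, every element of a primitive type appears with multiplicity one. -/
/-- A *type* is a finitely supported function `f : ℚ →₀ ℕ` whose support lies in `[0,1)`
and such that `f x + f (fract (-x))` depends only on the denominator of `x` (in lowest
terms), for `x ∈ [0,1)`. -/
def IsAgeType (f : ℚ →₀ ℕ) : Prop :=
  (∀ x ∈ f.support, 0 ≤ x ∧ x < 1) ∧
  ∀ x y : ℚ, 0 ≤ x → x < 1 → 0 ≤ y → y < 1 → x.den = y.den →
    f x + f (Int.fract (-x)) = f y + f (Int.fract (-y))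

/-- A type is *primitive* if it is nonzero and is not the pointwise sum of two
nonzero types. -/
def IsPrimitiveType (f : ℚ →₀ ℕ) : Prop :=
  IsAgeType f ∧ f ≠ 0 ∧
    ¬ ∃ g h : ℚ →₀ ℕ, IsAgeType g ∧ IsAgeType h ∧ g ≠ 0 ∧ h ≠ 0 ∧ f = g + h

/-- The *weight* of a type: `∑ x·f(x)` over the support of `f`. -/
def typeWeight (f : ℚ →₀ ℕ) : ℚ :=
  ∑ x ∈ f.support, x * f x

theorem den_fract_neg (x : ℚ) : (Int.fract (-x)).den = x.den := by
  rw [Int.fract, Rat.sub_intCast_den, Rat.neg_den]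

theorem fract_neg_fract_neg {x : ℚ} (h0 : 0 ≤ x) (h1 : x < 1) :
    Int.fract (-Int.fract (-x)) = x := by
  rw [Int.fract_eq_iff]
  refine ⟨h0, h1, ⌊-x⌋, ?_⟩
  rw [Int.fract]
  ring

theorem eq_of_den_eq_of_fract_neg_eq {x y : ℚ} (hx0 : 0 ≤ x) (hx1 : x < 1) (hy0 : 0 ≤ y)
    (hy1 : y < 1) (h : Int.fract (-x) = x) (hd : x.den = y.den) : y = x := by
  obtain ⟨-, -, k, hk⟩ := Int.fract_eq_iff.1 h
  have hk' : (k : ℚ) = -(2 * x) := by linarith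
  have hlt : (-2 : ℚ) < k := by linarith
  have hle : (k : ℚ) ≤ 0 := by linarith
  have hlt' : -2 < k := by exact_mod_cast hlt
  have hle' : k ≤ 0 := by exact_mod_cast hle
  have hyd : (y.num : ℚ) = y * y.den := (Rat.mul_den_eq_num y).symm
  obtain rfl | rfl : k = 0 ∨ k = -1 := by omega
  · obtain rfl : x = 0 := by push_cast at hk'; linarith
    rw [← hd] at hyd
    simp only [Rat.den_ofNat, Nat.cast_one, mul_one] at hyd
    have a : y.num < 1 := by exact_mod_cast hyd.trans_lt hy1
    have b : 0 ≤ y.num := Rat.num_nonneg.2 hy0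
    exact Rat.num_eq_zero.1 (by omega)
  · obtain rfl : x = 1 / 2 := by push_cast at hk'; linarith
    have h2 : y.den = 2 := by rw [← hd]; norm_num
    rw [h2] at hyd
    push_cast at hyd
    have a : (y.num : ℚ) < 2 := by linarith
    have a' : y.num < 2 := by exact_mod_cast a
    have b : 0 ≤ y.num := Rat.num_nonneg.2 hy0
    obtain h0 | h1 : y.num = 0 ∨ y.num = 1 := by omega
    · rw [Rat.num_eq_zero.1 h0] at h2
      norm_num at h2
    · rw [h1] at hyd
      push_cast at hyd
      linarith

theorem IsAgeType.sub {f g : ℚ →₀ ℕ} (hf : IsAgeType f) (hg : IsAgeType g) (hle : g ≤ f) :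
    IsAgeType (f - g) := by
  refine ⟨fun x hx => hf.1 x ?_, fun x y hx0 hx1 hy0 hy1 hd => ?_⟩
  · rw [Finsupp.mem_support_iff, Finsupp.tsub_apply] at hx
    rw [Finsupp.mem_support_iff]
    omega
  · have h1 := hf.2 x y hx0 hx1 hy0 hy1 hd
    have h2 := hg.2 x y hx0 hx1 hy0 hy1 hd
    have h3 := hle x
    have h4 := hle y
    have h5 := hle (Int.fract (-x))
    have h6 := hle (Int.fract (-y))
    simp only [Finsupp.tsub_apply]
    omega

open Classical in
/-- Select with multiplicity one, from every pair `{x, fract (-x)}` of denominator `n`, the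
smaller element of the support of `f`. -/
noncomputable def pairSelection (f : ℚ →₀ ℕ) (n : ℕ) : ℚ →₀ ℕ :=
  Finsupp.onFinset f.support
    (fun x => if x.den = n ∧ f x ≠ 0 ∧ (x ≤ Int.fract (-x) ∨ f (Int.fract (-x)) = 0)
      then 1 else 0)
    (fun x hx => by
      rw [Finsupp.mem_support_iff]
      by_contra h
      simp [h] at hx)

open Classical in
theorem pairSelection_apply (f : ℚ →₀ ℕ) (n : ℕ) (x : ℚ) :
    pairSelection f n x =
      if x.den = n ∧ f x ≠ 0 ∧ (x ≤ Int.fract (-x) ∨ f (Int.fract (-x)) = 0) then 1 else 0 :=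
  rfl

theorem pairSelection_le_one (f : ℚ →₀ ℕ) (n : ℕ) (x : ℚ) : pairSelection f n x ≤ 1 := by
  rw [pairSelection_apply]
  split_ifs <;> omega

theorem pairSelection_le (f : ℚ →₀ ℕ) (n : ℕ) : pairSelection f n ≤ f := by
  intro x
  rw [pairSelection_apply]
  split_ifs <;> omega

theorem pairSelection_of_den_ne (f : ℚ →₀ ℕ) {n : ℕ} {x : ℚ} (h : x.den ≠ n) :
    pairSelection f n x = 0 := by
  simp [pairSelection_apply, h]

theorem pairSelection_add {f : ℚ →₀ ℕ} {x : ℚ} (h0 : 0 ≤ x) (h1 : x < 1)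
    (hne : Int.fract (-x) ≠ x) (hpos : f x + f (Int.fract (-x)) ≠ 0) :
    pairSelection f x.den x + pairSelection f x.den (Int.fract (-x)) = 1 := by
  rw [pairSelection_apply, pairSelection_apply, fract_neg_fract_neg h0 h1, den_fract_neg]
  rcases lt_or_gt_of_ne hne with h | h
  · have := h.not_ge
    grind
  · have := h.not_ge
    grind

theorem IsAgeType.pairSelection {f : ℚ →₀ ℕ} (hf : IsAgeType f) {x : ℚ} (h0 : 0 ≤ x)
    (h1 : x < 1) (hx : f x ≠ 0) : IsAgeType (pairSelection f x.den) := by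
  refine ⟨fun y hy => hf.1 y ?_, fun y z hy0 hy1 hz0 hz1 hd => ?_⟩
  · have := pairSelection_le f x.den y
    rw [Finsupp.mem_support_iff] at hy ⊢
    omega
  by_cases hyx : y.den = x.den
  · by_cases hy : Int.fract (-y) = y
    · rw [eq_of_den_eq_of_fract_neg_eq hy0 hy1 hz0 hz1 hy hd]
    by_cases hz : Int.fract (-z) = z
    · rw [eq_of_den_eq_of_fract_neg_eq hz0 hz1 hy0 hy1 hz hd.symm]
    have hfy := hf.2 x y h0 h1 hy0 hy1 hyx.symm
    have hfz := hf.2 y z hy0 hy1 hz0 hz1 hd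
    have hsy := pairSelection_add (f := f) hy0 hy1 hy (by omega)
    have hsz := pairSelection_add (f := f) hz0 hz1 hz (by omega)
    rw [← hyx, hsy, hd, hsz]
  · have hzx : z.den ≠ x.den := hd ▸ hyx
    rw [pairSelection_of_den_ne f hyx, pairSelection_of_den_ne f hzx,
      pairSelection_of_den_ne f (by rwa [den_fract_neg]),
      pairSelection_of_den_ne f (by rwa [den_fract_neg])]

theorem pairSelection_ne_zero {f : ℚ →₀ ℕ} {x : ℚ} (h0 : 0 ≤ x) (h1 : x < 1) (hx : f x ≠ 0) :
    pairSelection f x.den ≠ 0 := by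
  intro h
  by_cases hfix : Int.fract (-x) = x
  · have := DFunLike.congr_fun h x
    simp [pairSelection_apply, hfix, hx] at this
  · have := pairSelection_add (f := f) h0 h1 hfix (by omega)
    simp [h] at this

theorem primitiveType_multiplicity_le_one (f : ℚ →₀ ℕ) (hf : IsPrimitiveType f) :
    ∀ x : ℚ, f x ≤ 1 := by
  intro x
  by_contra! hx
  obtain ⟨hT, -, hprim⟩ := hf
  have hx0 : f x ≠ 0 := by omega
  obtain ⟨h0, h1⟩ := hT.1 x (Finsupp.mem_support_iff.2 hx0)
  have hle := pairSelection_le f x.den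
  have hS := hT.pairSelection h0 h1 hx0
  refine hprim ⟨_, f - pairSelection f x.den, hS, hT.sub hS hle,
    pairSelection_ne_zero h0 h1 hx0, fun h => ?_, (add_tsub_cancel_of_le hle).symm⟩
  have h' := DFunLike.congr_fun h x
  have := pairSelection_le_one f x.den x
  rw [Finsupp.tsub_apply, Finsupp.zero_apply] at h'
  omega
end

section
/- Let f be a primitive type of denominator n with n ≥ 3, and suppose the weight of f is at most 1. If a is an integer with 0 < a < n/2, gcd(a,n) = 1, and f((n−a)/n) ≥ 1, then a is the largest integer in the open interval (0, n/2) that is coprime to n. -/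
theorem den_natCast_div_eq {m n : ℕ} (hn : 0 < n) (h : Nat.Coprime m n) :
    ((m : ℚ) / n).den = n := by
  have key := Rat.den_div_eq_of_coprime (a := (m : ℤ)) (b := (n : ℤ)) (by exact_mod_cast hn)
    (by simpa using h)
  simpa using key

theorem fract_neg_natCast_div {m n : ℕ} (hm : 0 < m) (hmn : m < n) :
    Int.fract (-((m : ℚ) / n)) = ((n - m : ℕ) : ℚ) / n := by
  have hn : (0 : ℚ) < n := by exact_mod_cast hm.trans hmn
  have hm' : (0 : ℚ) < m := by exact_mod_cast hm
  have hmn' : (m : ℚ) < n := by exact_mod_cast hmn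
  rw [Int.fract_eq_iff, Nat.cast_sub hmn.le]
  refine ⟨div_nonneg (by linarith) hn.le, (div_lt_one hn).2 (by linarith), -1, ?_⟩
  field_simp
  push_cast
  ring

/-- Two distinct points of the support of a type contribute at least their sum to the weight. -/
theorem IsAgeType.add_le_typeWeight {f : ℚ →₀ ℕ} (hf : IsAgeType f) {x y : ℚ} (hxy : x ≠ y)
    (hx : 1 ≤ f x) (hy : 1 ≤ f y) : x + y ≤ typeWeight f := by
  have hx' : x ∈ f.support := Finsupp.mem_support_iff.2 (by lia)
  have hy' : y ∈ f.support := Finsupp.mem_support_iff.2 (by lia)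
  have hsub : ({x, y} : Finset ℚ) ⊆ f.support := by
    simp [Finset.insert_subset_iff, hx', hy', -Finsupp.mem_support_iff]
  have key : ∑ z ∈ ({x, y} : Finset ℚ), z * (f z : ℚ) ≤ typeWeight f :=
    Finset.sum_le_sum_of_subset_of_nonneg hsub fun z hz _ =>
      mul_nonneg (hf.1 z hz).1 (Nat.cast_nonneg _)
  rw [Finset.sum_pair hxy] at key
  have h1 : x ≤ x * (f x : ℚ) := le_mul_of_one_le_right (hf.1 x hx').1 (by exact_mod_cast hx)
  have h2 : y ≤ y * (f y : ℚ) := le_mul_of_one_le_right (hf.1 y hy').1 (by exact_mod_cast hy)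
  linarith

theorem primitiveType_weight_le_one_largest (f : ℚ →₀ ℕ) (n : ℕ) (hn : 3 ≤ n)
    (hf : IsPrimitiveType f) (hden : ∀ x ∈ f.support, x.den = n)
    (hw : typeWeight f ≤ 1) (a : ℕ) (ha : 0 < a) (ha2 : 2 * a < n)
    (hcop : Nat.Coprime a n) (hmem : 1 ≤ f (((n - a : ℕ) : ℚ) / n)) :
    ∀ b : ℕ, 0 < b → 2 * b < n → Nat.Coprime b n → b ≤ a := by
  intro b hb hb2 hbcop
  by_contra! hab
  have hn0 : (0 : ℚ) < n := by exact_mod_cast (by lia : 0 < n)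
  have hpair := hf.1.2 ((a : ℚ) / n) ((b : ℚ) / n) (by positivity)
    ((div_lt_one hn0).2 (by exact_mod_cast (by lia : a < n))) (by positivity)
    ((div_lt_one hn0).2 (by exact_mod_cast (by lia : b < n)))
    (by rw [den_natCast_div_eq (by lia) hcop, den_natCast_div_eq (by lia) hbcop])
  rw [fract_neg_natCast_div ha (by lia), fract_neg_natCast_div hb (by lia)] at hpair
  have hcontra : ∀ c : ℕ, b ≤ c → c ≠ n - a → ¬ 1 ≤ f ((c : ℚ) / n) := by
    intro c hbc hne hc
    have hne' : ((n - a : ℕ) : ℚ) / n ≠ (c : ℚ) / n := by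
      rw [Ne, div_left_inj' hn0.ne']
      exact_mod_cast hne.symm
    have hle := (hf.1.add_le_typeWeight hne' hmem hc).trans hw
    rw [← add_div, div_le_one hn0] at hle
    have hle' : n - a + c ≤ n := by exact_mod_cast hle
    lia
  have h1 := hcontra b le_rfl (by lia)
  have h2 := hcontra (n - b) (by lia) (by lia)
  lia
end

section
/- Let f be a primitive type of denominator n with n ≥ 3. Then the weight of f is at least (1/(2n))·∑_{x ∈ S_n} min(x, n−x), where S_n is the set of positive integers x < n with gcd(x,n) = 1. -/
lemma den_natCast_div_natCast {k n : ℕ} (hn : n ≠ 0) (h : k.Coprime n) :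
    ((k : ℚ) / n).den = n := by
  have := Rat.den_div_eq_of_coprime (a := k) (b := n) (by omega) (by simpa using h)
  push_cast at this
  exact_mod_cast this

lemma fract_neg_natCast_div_s11 {k n : ℕ} (hk : 1 ≤ k) (hkn : k < n) :
    Int.fract (-((k : ℚ) / n)) = ((n - k : ℕ) : ℚ) / n := by
  have hn : (0 : ℚ) < n := by exact_mod_cast hk.trans hkn.le
  rw [Int.fract_eq_iff]
  refine ⟨by positivity, ?_, -1, ?_⟩
  · rw [div_lt_one hn]
    exact_mod_cast (by omega : n - k < n)
  · rw [Nat.cast_sub hkn.le]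
    field_simp
    push_cast
    ring

/-- The reflection `k ↦ n - k` permutes the positive integers below `n` coprime to `n`. -/
lemma sum_coprime_reflect (n : ℕ) (g : ℕ → ℚ) :
    ∑ k ∈ (Finset.Ico 1 n).filter (fun k => Nat.Coprime k n), g (n - k) =
      ∑ k ∈ (Finset.Ico 1 n).filter (fun k => Nat.Coprime k n), g k := by
  have hmem : ∀ k ∈ (Finset.Ico 1 n).filter (fun k => Nat.Coprime k n),
      n - k ∈ (Finset.Ico 1 n).filter (fun k => Nat.Coprime k n) := by
    intro k hk
    simp only [Finset.mem_filter, Finset.mem_Ico] at hk ⊢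
    exact ⟨by omega, (Nat.coprime_self_sub_left hk.1.2.le).2 hk.2⟩
  refine Finset.sum_nbij' (fun k => n - k) (fun k => n - k) hmem hmem ?_ ?_ (fun _ _ => rfl) <;>
  · intro k hk
    simp only [Finset.mem_filter, Finset.mem_Ico] at hk
    omega

/-- The weight of a type of denominator `n` as a sum over numerators. -/
lemma typeWeight_eq_sum_coprime {f : ℚ →₀ ℕ} {n : ℕ} (hn : 2 ≤ n) (hf : IsAgeType f)
    (hden : ∀ x ∈ f.support, x.den = n) :
    typeWeight f = ∑ k ∈ (Finset.Ico 1 n).filter (fun k => Nat.Coprime k n),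
      (k / n : ℚ) * f (k / n) := by
  have hn0 : (n : ℚ) ≠ 0 := by positivity
  have hinj : Function.Injective (fun k : ℕ => (k / n : ℚ)) := fun a b h => by
    simpa [div_left_inj' hn0] using h
  rw [← Finset.sum_image (f := fun x : ℚ => x * f x) (g := fun k : ℕ => (k / n : ℚ))
    hinj.injOn]
  refine Finset.sum_subset (fun x hx => ?_) (fun x _ hx => by simp_all)
  obtain ⟨h0, h1⟩ := hf.1 x hx
  have hd := hden x hx
  have hnum : (x.num.natAbs : ℤ) = x.num := Int.natAbs_of_nonneg (Rat.num_nonneg.2 h0)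
  have hxeq : ((x.num.natAbs : ℕ) : ℚ) / n = x := by
    rw [← hd, ← Int.cast_natCast x.num.natAbs, hnum]
    exact Rat.num_div_den x
  have hcop : x.num.natAbs.Coprime n := hd ▸ x.reduced
  refine Finset.mem_image.2 ⟨x.num.natAbs, ?_, hxeq⟩
  simp only [Finset.mem_filter, Finset.mem_Ico]
  refine ⟨⟨Nat.one_le_iff_ne_zero.2 fun h => ?_, ?_⟩, hcop⟩
  · rw [h, Nat.coprime_zero_left] at hcop
    omega
  · rw [← hxeq, div_lt_one (by positivity)] at h1
    exact_mod_cast h1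

theorem primitiveType_weight_lower_bound (f : ℚ →₀ ℕ) (n : ℕ) (hn : 3 ≤ n)
    (hf : IsPrimitiveType f) (hden : ∀ x ∈ f.support, x.den = n) :
    typeWeight f ≥ (1 / (2 * (n : ℚ))) *
      ∑ x ∈ (Finset.Ico 1 n).filter (fun x => Nat.Coprime x n), (min x (n - x) : ℚ) := by
  obtain ⟨hT, hne, -⟩ := hf
  have hnpos : (0 : ℚ) < n := by positivity
  obtain ⟨y, hy⟩ := Finsupp.support_nonempty_iff.2 hne
  have hW := typeWeight_eq_sum_coprime (by omega) hT hden
  have hW' := hW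
  rw [← sum_coprime_reflect] at hW'
  have key : ∑ k ∈ (Finset.Ico 1 n).filter (fun k => Nat.Coprime k n),
      (min k (n - k) : ℚ) / n ≤ typeWeight f + typeWeight f := by
    nth_rewrite 1 [hW]
    rw [hW', ← Finset.sum_add_distrib]
    refine Finset.sum_le_sum fun k hk => ?_
    simp only [Finset.mem_filter, Finset.mem_Ico] at hk
    obtain ⟨⟨hk1, hkn⟩, hcop⟩ := hk
    have hkn' : (k : ℚ) < n := by exact_mod_cast hkn
    have hsum := hT.2 (k / n) y (by positivity) ((div_lt_one hnpos).2 hkn') (hT.1 y hy).1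
      (hT.1 y hy).2 ((den_natCast_div_natCast (by omega) hcop).trans (hden y hy).symm)
    rw [fract_neg_natCast_div_s11 hk1 hkn] at hsum
    have hypos : f y ≠ 0 := Finsupp.mem_support_iff.1 hy
    have hone : (1 : ℚ) ≤ f (k / n) + f ((n - k : ℕ) / n) := by
      exact_mod_cast (by omega : 1 ≤ f (k / n) + f ((n - k : ℕ) / n))
    have hmin : (0 : ℚ) ≤ min (k : ℚ) (n - k) / n :=
      div_nonneg (le_min (by positivity) (by linarith)) hnpos.le
    calc min (k : ℚ) (n - k) / n
        ≤ min (k : ℚ) (n - k) / n * (f (k / n) + f ((n - k : ℕ) / n)) :=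
          le_mul_of_one_le_right hmin hone
      _ ≤ _ := by
          rw [mul_add]
          gcongr
          · exact min_le_left _ _
          · rw [Nat.cast_sub hkn.le]
            exact min_le_right _ _
  rw [← Finset.sum_div] at key
  rw [ge_iff_le, one_div_mul_eq_div, mul_comm, ← div_div]
  linarith
end

section
/- Let f be a primitive type of denominator n with n ≥ 3, and suppose the weight of f is at most 1. Then φ(n) ≤ 24 (and consequently n ≤ 90). -/
/-- If an integer combination of `a` and `b` is a power of a prime `q` that is not a common
divisor of `a` and `b`, then `a` and `b` are coprime. -/
theorem coprime_of_combination_eq_prime_pow {a b q t : ℕ} (hq : q.Prime) (x y : ℤ)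
    (h : (a : ℤ) * x + b * y = (q : ℤ) ^ t) (hab : ¬ (q ∣ a ∧ q ∣ b)) : a.Coprime b := by
  have hdvd : Nat.gcd a b ∣ q ^ t := by
    have hint : ((Nat.gcd a b : ℕ) : ℤ) ∣ (q : ℤ) ^ t := by
      rw [← h]
      exact dvd_add (Dvd.dvd.mul_right (Int.natCast_dvd_natCast.2 (Nat.gcd_dvd_left a b)) x)
        (Dvd.dvd.mul_right (Int.natCast_dvd_natCast.2 (Nat.gcd_dvd_right a b)) y)
    exact_mod_cast hint
  obtain ⟨i, -, hi⟩ := (Nat.dvd_prime_pow hq).1 hdvd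
  rcases Nat.eq_zero_or_pos i with rfl | hpos
  · simpa using hi
  · have hqg : q ∣ Nat.gcd a b := hi ▸ dvd_pow_self q hpos.ne'
    exact absurd ⟨hqg.trans (Nat.gcd_dvd_left a b), hqg.trans (Nat.gcd_dvd_right a b)⟩ hab

theorem coprime_three_right {a : ℕ} (h : ¬ 3 ∣ a) : a.Coprime 3 :=
  ((Nat.Prime.coprime_iff_not_dvd Nat.prime_three).2 h).symm

theorem coprime_four_right {a : ℕ} (h : ¬ 2 ∣ a) : a.Coprime 4 :=
  (((Nat.Prime.coprime_iff_not_dvd Nat.prime_two).2 h).symm).pow_right 2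

/-- There is a set of positive integers below `n / 2`, coprime to `n`, whose sum exceeds `n`. -/
def HasLargeCoprimeSum (n : ℕ) : Prop :=
  ∃ s : Finset ℕ, (∀ a ∈ s, 0 < a ∧ 2 * a < n ∧ a.Coprime n) ∧ n < ∑ a ∈ s, a

theorem hasLargeCoprimeSum_two_mul {m : ℕ} (hm : 15 ≤ m) (hodd : ¬ 2 ∣ m) :
    HasLargeCoprimeSum (2 * m) := by
  have key : ∀ a t : ℕ, a + 2 ^ (t + 1) = m → a.Coprime (2 * m) := by
    intro a t hat
    have h2 : ¬ 2 ∣ a := by rw [pow_succ] at hat; omega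
    refine Nat.Coprime.mul_right ((Nat.Prime.coprime_iff_not_dvd Nat.prime_two).2 h2).symm ?_
    refine coprime_of_combination_eq_prime_pow (t := t + 1) Nat.prime_two (-1) 1 ?_ (by tauto)
    rw [← hat]; push_cast; ring
  refine ⟨{m - 2, m - 4, m - 8}, ?_, ?_⟩
  · simp only [Finset.mem_insert, Finset.mem_singleton]
    rintro a (rfl | rfl | rfl)
    · exact ⟨by omega, by omega, key _ 0 (by omega)⟩
    · exact ⟨by omega, by omega, key _ 1 (by omega)⟩
    · exact ⟨by omega, by omega, key _ 2 (by omega)⟩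
  · rw [Finset.sum_insert (by simp; omega), Finset.sum_insert (by simp; omega),
      Finset.sum_singleton]
    omega

theorem exists_coprime_near_quarter {m : ℕ} (hm : 3 ≤ m) :
    ∃ d, (d = 1 ∨ d = 2) ∧ (m - d).Coprime (4 * m) ∧ (m + d).Coprime (4 * m) := by
  obtain ⟨d, hd, hpar⟩ : ∃ d, (d = 1 ∨ d = 2) ∧ ¬ 2 ∣ m + d := by
    by_cases h : 2 ∣ m
    · exact ⟨1, by omega, by omega⟩
    · exact ⟨2, by omega, by omega⟩
  obtain ⟨t, ht⟩ : ∃ t, d = 2 ^ t := by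
    rcases hd with rfl | rfl
    · exact ⟨0, rfl⟩
    · exact ⟨1, rfl⟩
  have ht' : (d : ℤ) = ((2 : ℕ) : ℤ) ^ t := by rw [ht]; push_cast; rfl
  refine ⟨d, hd, Nat.Coprime.mul_right (coprime_four_right (by omega)) ?_,
    Nat.Coprime.mul_right (coprime_four_right (by omega)) ?_⟩
  · refine coprime_of_combination_eq_prime_pow (t := t) Nat.prime_two (-1) 1 ?_ (by omega)
    rw [Nat.cast_sub (by omega), ← ht']; ring
  · refine coprime_of_combination_eq_prime_pow (t := t) Nat.prime_two 1 (-1) ?_ (by omega)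
    rw [← ht']; push_cast; ring

theorem hasLargeCoprimeSum_four_mul {m : ℕ} (hm : 12 ≤ m) : HasLargeCoprimeSum (4 * m) := by
  obtain ⟨d, hd, hsub, hadd⟩ := exists_coprime_near_quarter (m := m) (by omega)
  have hhalf : (2 * m - 1).Coprime (4 * m) := by
    refine Nat.Coprime.mul_right (coprime_four_right (by omega)) ?_
    refine coprime_of_combination_eq_prime_pow (t := 0) Nat.prime_two (-1) 2 ?_ (by omega)
    rw [Nat.cast_sub (by omega)]; push_cast; ring
  obtain ⟨e, hlow, hhigh, hne1, hne2, he⟩ : ∃ e, 1 < e ∧ e < 2 * m - 1 ∧ e ≠ m - d ∧ e ≠ m + d ∧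
      e.Coprime (4 * m) := by
    by_cases h3 : 3 ∣ m
    · obtain ⟨l, rfl⟩ := h3
      by_cases hl : l % 3 = 2
      · refine ⟨4 * l - 1, by omega, by omega, by omega, by omega, ?_⟩
        refine Nat.Coprime.mul_right (coprime_four_right (by omega))
          (Nat.Coprime.mul_right (coprime_three_right (by omega)) ?_)
        refine coprime_of_combination_eq_prime_pow (t := 0) Nat.prime_two (-1) 4 ?_ (by omega)
        rw [Nat.cast_sub (by omega)]; push_cast; ring
      · refine ⟨4 * l + 1, by omega, by omega, by omega, by omega, ?_⟩
        refine Nat.Coprime.mul_right (coprime_four_right (by omega))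
          (Nat.Coprime.mul_right (coprime_three_right (by omega)) ?_)
        refine coprime_of_combination_eq_prime_pow (t := 0) Nat.prime_two 1 (-4) ?_ (by omega)
        push_cast; ring
    · exact ⟨3, by omega, by omega, by omega, by omega, Nat.Coprime.mul_right (by norm_num)
        (coprime_three_right h3).symm⟩
  refine ⟨{1, m - d, m + d, 2 * m - 1, e}, ?_, ?_⟩
  · simp only [Finset.mem_insert, Finset.mem_singleton]
    rintro a (rfl | rfl | rfl | rfl | rfl)
    · exact ⟨by omega, by omega, Nat.coprime_one_left _⟩
    · exact ⟨by omega, by omega, hsub⟩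
    · exact ⟨by omega, by omega, hadd⟩
    · exact ⟨by omega, by omega, hhalf⟩
    · exact ⟨by omega, by omega, he⟩
  · rw [Finset.sum_insert (by simp; omega), Finset.sum_insert (by simp; omega),
      Finset.sum_insert (by simp; omega), Finset.sum_insert (by simp; omega),
      Finset.sum_singleton]
    omega

theorem hasLargeCoprimeSum_three_mul {k : ℕ} (hk : 17 ≤ k) (hodd : ¬ 2 ∣ k) :
    HasLargeCoprimeSum (3 * k) := by
  have hadd : ∀ t : ℕ, ¬ 3 ∣ k + 2 ^ t → (k + 2 ^ t).Coprime (3 * k) := by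
    intro t h3
    refine Nat.Coprime.mul_right (coprime_three_right h3) ?_
    refine coprime_of_combination_eq_prime_pow (t := t) Nat.prime_two 1 (-1) ?_ (by tauto)
    push_cast; ring
  have hsub : ∀ t : ℕ, 2 ^ t ≤ k → ¬ 3 ∣ k - 2 ^ t → (k - 2 ^ t).Coprime (3 * k) := by
    intro t hle h3
    refine Nat.Coprime.mul_right (coprime_three_right h3) ?_
    refine coprime_of_combination_eq_prime_pow (t := t) Nat.prime_two (-1) 1 ?_ (by tauto)
    rw [Nat.cast_sub hle]; push_cast; ring
  by_cases h : k % 3 = 2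
  · refine ⟨{k - 2 ^ 0, k - 2 ^ 2, k + 2 ^ 1, k + 2 ^ 3}, ?_, ?_⟩
    · simp only [Finset.mem_insert, Finset.mem_singleton]
      rintro a (rfl | rfl | rfl | rfl)
      · exact ⟨by omega, by omega, hsub _ (by omega) (by omega)⟩
      · exact ⟨by omega, by omega, hsub _ (by omega) (by omega)⟩
      · exact ⟨by omega, by omega, hadd _ (by omega)⟩
      · exact ⟨by omega, by omega, hadd _ (by omega)⟩
    · rw [Finset.sum_insert (by simp; omega), Finset.sum_insert (by simp; omega),
        Finset.sum_insert (by simp), Finset.sum_singleton]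
      omega
  by_cases h' : k % 3 = 1
  · refine ⟨{k + 2 ^ 0, k + 2 ^ 2, k - 2 ^ 1, k - 2 ^ 3}, ?_, ?_⟩
    · simp only [Finset.mem_insert, Finset.mem_singleton]
      rintro a (rfl | rfl | rfl | rfl)
      · exact ⟨by omega, by omega, hadd _ (by omega)⟩
      · exact ⟨by omega, by omega, hadd _ (by omega)⟩
      · exact ⟨by omega, by omega, hsub _ (by omega) (by omega)⟩
      · exact ⟨by omega, by omega, hsub _ (by omega) (by omega)⟩
    · rw [Finset.sum_insert (by simp; omega), Finset.sum_insert (by simp; omega),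
        Finset.sum_insert (by simp; omega), Finset.sum_singleton]
      omega
  · refine ⟨{k + 2 ^ 0, k + 2 ^ 2, k - 2 ^ 0, k - 2 ^ 2}, ?_, ?_⟩
    · simp only [Finset.mem_insert, Finset.mem_singleton]
      rintro a (rfl | rfl | rfl | rfl)
      · exact ⟨by omega, by omega, hadd _ (by omega)⟩
      · exact ⟨by omega, by omega, hadd _ (by omega)⟩
      · exact ⟨by omega, by omega, hsub _ (by omega) (by omega)⟩
      · exact ⟨by omega, by omega, hsub _ (by omega) (by omega)⟩
    · rw [Finset.sum_insert (by simp; omega), Finset.sum_insert (by simp; omega),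
        Finset.sum_insert (by simp; omega), Finset.sum_singleton]
      omega

theorem hasLargeCoprimeSum_two_mul_add_one {h : ℕ} (hh : 4 ≤ h) (h3 : ¬ 3 ∣ 2 * h + 1) :
    HasLargeCoprimeSum (2 * h + 1) := by
  refine ⟨{1, 2, h - 1, h}, ?_, ?_⟩
  · simp only [Finset.mem_insert, Finset.mem_singleton]
    rintro a (rfl | rfl | rfl | rfl)
    · exact ⟨by omega, by omega, Nat.coprime_one_left _⟩
    · exact ⟨by omega, by omega, (Nat.Prime.coprime_iff_not_dvd Nat.prime_two).2 (by omega)⟩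
    · refine ⟨by omega, by omega, ?_⟩
      refine coprime_of_combination_eq_prime_pow (t := 1) Nat.prime_three (-2) 1 ?_ (by tauto)
      rw [Nat.cast_sub (by omega)]; push_cast; ring
    · refine ⟨by omega, by omega, ?_⟩
      refine coprime_of_combination_eq_prime_pow (t := 0) Nat.prime_three (-2) 1 ?_ (by tauto)
      push_cast; ring
  · rw [Finset.sum_insert (by simp; omega), Finset.sum_insert (by simp; omega),
      Finset.sum_insert (by simp; omega), Finset.sum_singleton]
    omega

theorem hasLargeCoprimeSum_of_le {n : ℕ} (hn : 51 ≤ n) : HasLargeCoprimeSum n := by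
  by_cases h2 : 2 ∣ n
  · obtain ⟨m, rfl⟩ := h2
    by_cases h4 : 2 ∣ m
    · obtain ⟨l, rfl⟩ := h4
      rw [← mul_assoc]
      exact hasLargeCoprimeSum_four_mul (by omega)
    · exact hasLargeCoprimeSum_two_mul (by omega) h4
  · by_cases h3 : 3 ∣ n
    · obtain ⟨k, rfl⟩ := h3
      exact hasLargeCoprimeSum_three_mul (by omega) (by omega)
    · obtain ⟨h, rfl⟩ : ∃ h, n = 2 * h + 1 := ⟨n / 2, by omega⟩
      exact hasLargeCoprimeSum_two_mul_add_one (by omega) h3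

theorem hasLargeCoprimeSum_of_totient {n : ℕ} (hn : 24 < n.totient) : HasLargeCoprimeSum n := by
  rcases le_or_gt 51 n with h | h
  · exact hasLargeCoprimeSum_of_le h
  · have hsmall : ∀ n < 51, 24 < n.totient → n % 2 = 1 ∧ n % 3 ≠ 0 ∧ 9 ≤ n := by decide +kernel
    obtain ⟨h2, h3, h9⟩ := hsmall n h hn
    obtain ⟨k, rfl⟩ : ∃ k, n = 2 * k + 1 := ⟨n / 2, by omega⟩
    exact hasLargeCoprimeSum_two_mul_add_one (by omega) (by omega)

theorem den_natCast_div_of_coprime {a n : ℕ} (hn : 0 < n) (h : a.Coprime n) :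
    ((a : ℚ) / n).den = n := by
  have := Rat.den_div_eq_of_coprime (a := (a : ℤ)) (b := (n : ℤ)) (by exact_mod_cast hn) (by simpa)
  rw [Int.cast_natCast, Int.cast_natCast] at this
  exact Int.natCast_inj.1 this

theorem fract_neg_eq_one_sub {x : ℚ} (h0 : 0 < x) (h1 : x < 1) : Int.fract (-x) = 1 - x := by
  rw [Int.fract_eq_iff]
  exact ⟨by linarith, by linarith, -1, by push_cast; ring⟩

/-- Each pair `x, 1 - x` of fractions of denominator `n` meets the support of a nonzero type
of denominator `n`. -/
theorem one_le_add_of_isAgeType {f : ℚ →₀ ℕ} {n : ℕ} (hf : IsAgeType f) (hf0 : f ≠ 0)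
    (hden : ∀ x ∈ f.support, x.den = n) {x : ℚ} (h0 : 0 < x) (h1 : x < 1) (hx : x.den = n) :
    1 ≤ f x + f (1 - x) := by
  obtain ⟨y, hy⟩ := Finsupp.support_nonempty_iff.2 hf0
  have hxy := hf.2 x y h0.le h1 (hf.1 y hy).1 (hf.1 y hy).2 (hx.trans (hden y hy).symm)
  rw [fract_neg_eq_one_sub h0 h1] at hxy
  have := Finsupp.mem_support_iff.1 hy
  omega

theorem sum_le_mul_typeWeight {f : ℚ →₀ ℕ} {n : ℕ} (hn : 0 < n) (hf : IsAgeType f) (hf0 : f ≠ 0)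
    (hden : ∀ x ∈ f.support, x.den = n) {s : Finset ℕ}
    (hs : ∀ a ∈ s, 0 < a ∧ 2 * a < n ∧ a.Coprime n) :
    ((∑ a ∈ s, a : ℕ) : ℚ) ≤ n * typeWeight f := by
  have hn' : (0 : ℚ) < n := by exact_mod_cast hn
  have hpos : ∀ a ∈ s, (0 : ℚ) < a / n := fun a ha => by
    have : (0 : ℚ) < a := by exact_mod_cast (hs a ha).1
    positivity
  have hhalf : ∀ a ∈ s, (a : ℚ) / n < 1 / 2 := fun a ha => by
    have : (2 * a : ℚ) < n := by exact_mod_cast (hs a ha).2.1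
    rw [div_lt_div_iff₀ hn' (by norm_num)]
    linarith
  have hinj : Set.InjOn (fun a : ℕ => (a : ℚ) / n) s := by
    intro a _ b _ hab
    have := (div_left_inj' hn'.ne').1 hab
    exact_mod_cast this
  set A := s.image (fun a : ℕ => (a : ℚ) / n) with hA
  have hApos : ∀ x ∈ A, 0 < x ∧ x < 1 / 2 := by
    intro x hx
    obtain ⟨a, ha, rfl⟩ := Finset.mem_image.1 hx
    exact ⟨hpos a ha, hhalf a ha⟩
  have hAden : ∀ x ∈ A, x.den = n := by
    intro x hx
    obtain ⟨a, ha, rfl⟩ := Finset.mem_image.1 hx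
    exact den_natCast_div_of_coprime hn (hs a ha).2.2
  have hdisj : Disjoint A (A.image (fun x => 1 - x)) := by
    rw [Finset.disjoint_left]
    intro x hx hx'
    obtain ⟨y, hy, rfl⟩ := Finset.mem_image.1 hx'
    linarith [(hApos y hy).2, (hApos _ hx).2]
  have hweight : ∑ x ∈ A ∪ A.image (fun x => 1 - x), x * (f x : ℚ) ≤ typeWeight f := by
    have hsupp : typeWeight f =
        ∑ x ∈ f.support ∪ (A ∪ A.image (fun x => 1 - x)), x * (f x : ℚ) := by
      refine Finset.sum_subset Finset.subset_union_left ?_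
      intro x _ hx
      simp [Finsupp.notMem_support_iff.1 hx]
    rw [hsupp]
    refine Finset.sum_le_sum_of_subset_of_nonneg Finset.subset_union_right ?_
    intro x _ _
    by_cases hx : x ∈ f.support
    · exact mul_nonneg (hf.1 x hx).1 (Nat.cast_nonneg _)
    · simp [Finsupp.notMem_support_iff.1 hx]
  rw [Finset.sum_union hdisj, Finset.sum_image (fun x _ y _ h => sub_right_injective h),
    ← Finset.sum_add_distrib] at hweight
  have hterm : ∑ x ∈ A, x ≤ ∑ x ∈ A, (x * (f x : ℚ) + (1 - x) * (f (1 - x) : ℚ)) := by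
    refine Finset.sum_le_sum fun x hx => ?_
    obtain ⟨h0, h1⟩ := hApos x hx
    have hone : (1 : ℚ) ≤ f x + f (1 - x) := by
      exact_mod_cast one_le_add_of_isAgeType hf hf0 hden h0 (by linarith) (hAden x hx)
    have hnonneg : (0 : ℚ) ≤ f (1 - x) := Nat.cast_nonneg _
    nlinarith
  rw [hA, Finset.sum_image hinj, ← hA, ← Finset.sum_div] at hterm
  have := (div_le_iff₀' hn').1 (hterm.trans hweight)
  rwa [Nat.cast_sum]

theorem not_hasLargeCoprimeSum {f : ℚ →₀ ℕ} {n : ℕ} (hn : 0 < n) (hf : IsAgeType f) (hf0 : f ≠ 0)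
    (hden : ∀ x ∈ f.support, x.den = n) (hw : typeWeight f ≤ 1) : ¬ HasLargeCoprimeSum n := by
  rintro ⟨s, hs, hlarge⟩
  have hsum := sum_le_mul_typeWeight hn hf hf0 hden hs
  have hmul : (n : ℚ) * typeWeight f ≤ n * 1 := mul_le_mul_of_nonneg_left hw (Nat.cast_nonneg n)
  have hlarge' : (n : ℚ) < ((∑ a ∈ s, a : ℕ) : ℚ) := by exact_mod_cast hlarge
  linarith

theorem primitiveType_weight_le_one_totient_le (f : ℚ →₀ ℕ) (n : ℕ) (hn : 3 ≤ n)
    (hf : IsPrimitiveType f) (hden : ∀ x ∈ f.support, x.den = n)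
    (hw : typeWeight f ≤ 1) :
    Nat.totient n ≤ 24 ∧ n ≤ 90 := by
  have hnot := not_hasLargeCoprimeSum (by omega) hf.1 hf.2.1 hden hw
  constructor
  · by_contra! h
    exact hnot (hasLargeCoprimeSum_of_totient h)
  · by_contra! h
    exact hnot (hasLargeCoprimeSum_of_le (by omega))
end

section
/- There are exactly 35 reduced types of weight exactly 1; that is, the set of types f with f(0) = 0 and weight equal to 1 has cardinality 35. -/
/-- The numerators `a` of the reduced fractions `a / d` with `a / d < 1 / 2`. -/
def lowUnits (d : ℕ) : List ℕ := (List.range d).filter fun a => 2 * a < d ∧ a.Coprime d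

/-- The fractions `a / d` and `(d - a) / d` for `a` in a list, as numerator-denominator pairs. -/
def pairKeys (d : ℕ) (as : List ℕ) : List (ℕ × ℕ) := as.flatMap fun a => [(a, d), (d - a, d)]

/-- The reduced fractions in `(0, 1)` with denominator in `ds`, together with `1 / 2`. -/
def fracKeys (ds : List ℕ) : List (ℕ × ℕ) :=
  ds.flatMap (fun d => pairKeys d (lowUnits d)) ++ [(1, 2)]

/-- A table with at most one entry, omitted when the value is zero. -/
def entry (k : ℕ × ℕ) (n : ℕ) : List ((ℕ × ℕ) × ℕ) := if n = 0 then [] else [(k, n)]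

/-- The sparse table of values of `F` on a list of keys. -/
def entries (F : ℕ × ℕ → ℕ) (ks : List (ℕ × ℕ)) : List ((ℕ × ℕ) × ℕ) :=
  ks.flatMap fun k => entry k (F k)

/-- The weight of `F` on a list of keys, in units of `1 / 5040`. -/
def scaledWeight (F : ℕ × ℕ → ℕ) (ks : List (ℕ × ℕ)) : ℕ :=
  (ks.map fun k => k.1 * (5040 / k.2) * F k).sum

/-- The value of a sparse table at a key. -/
def tableValue (l : List ((ℕ × ℕ) × ℕ)) (k : ℕ × ℕ) : ℕ := (l.lookup k).getD 0

/-- Extends the tables found by `next` by values at the pairs `a / d`, `(d - a) / d` that sum to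
`c`, within the scaled weight `B`. -/
def pairSearch (d c : ℕ) (next : ℕ → List (List ((ℕ × ℕ) × ℕ))) :
    List ℕ → ℕ → List (List ((ℕ × ℕ) × ℕ))
  | [], B => next B
  | a :: as, B => (List.range (c + 1)).flatMap fun g =>
      if (a * (5040 / d) * (c - g) + (d - a) * (5040 / d) * g) ≤ B then
        (pairSearch d c next as
          (B - (a * (5040 / d) * (c - g) + (d - a) * (5040 / d) * g))).map
            fun l => entry (a, d) (c - g) ++ (entry (d - a, d) g ++ l)
      else []

/-- The tables of types of scaled weight `B` with denominators in `ds` or equal to `2`. -/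
def typeSearch : List ℕ → ℕ → List (List ((ℕ × ℕ) × ℕ))
  | [], B => if B % 2520 = 0 then [entry (1, 2) (B / 2520)] else []
  | d :: ds, B => (List.range (B / ((lowUnits d).sum * (5040 / d)) + 1)).flatMap fun c =>
      pairSearch d c (typeSearch ds) (lowUnits d) B

/-- The denominators other than `1` and `2` that can occur in a type of weight `1`. -/
def smallDens : List ℕ := [3, 4, 5, 6, 7, 8, 9, 10, 12, 14, 15, 16, 18, 20, 24]

/-- The tables of reduced types of weight one. -/
def weightOneTables : List (List ((ℕ × ℕ) × ℕ)) := typeSearch smallDens 5040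

theorem entries_append (F : ℕ × ℕ → ℕ) (ks ls : List (ℕ × ℕ)) :
    entries F (ks ++ ls) = entries F ks ++ entries F ls := by
  simp [entries]

theorem scaledWeight_append (F : ℕ × ℕ → ℕ) (ks ls : List (ℕ × ℕ)) :
    scaledWeight F (ks ++ ls) = scaledWeight F ks + scaledWeight F ls := by
  simp [scaledWeight]

theorem entries_append_mem_pairSearch {F : ℕ × ℕ → ℕ} {d c B : ℕ}
    {next : ℕ → List (List ((ℕ × ℕ) × ℕ))} {l : List ((ℕ × ℕ) × ℕ)} (hl : l ∈ next B) :
    ∀ {as : List ℕ}, (∀ a ∈ as, F (a, d) + F (d - a, d) = c) →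
      entries F (pairKeys d as) ++ l ∈
        pairSearch d c next as (scaledWeight F (pairKeys d as) + B)
  | [], _ => by simpa [pairSearch, pairKeys, entries, scaledWeight] using hl
  | a :: as, h => by
    have ih := entries_append_mem_pairSearch hl (as := as) fun b hb => h b (by simp [hb])
    have ha := h a (by simp)
    have hsub : c - F (d - a, d) = F (a, d) := by omega
    simp only [pairSearch, List.mem_flatMap, List.mem_range]
    refine ⟨F (d - a, d), by omega, ?_⟩
    have hw : scaledWeight F (pairKeys d (a :: as)) + B =
        a * (5040 / d) * F (a, d) + (d - a) * (5040 / d) * F (d - a, d) +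
          (scaledWeight F (pairKeys d as) + B) := by
      simp only [pairKeys, scaledWeight, List.flatMap_cons, List.cons_append, List.nil_append,
        List.map_cons, List.sum_cons]
      ring
    rw [hsub, hw, if_pos (Nat.le_add_right _ _), Nat.add_sub_cancel_left]
    refine List.mem_map.mpr ⟨_, ih, ?_⟩
    simp [entries, pairKeys]

theorem mul_sum_le_scaledWeight {F : ℕ × ℕ → ℕ} {d c : ℕ} :
    ∀ {as : List ℕ}, (∀ a ∈ as, 2 * a < d ∧ F (a, d) + F (d - a, d) = c) →
      c * (as.sum * (5040 / d)) ≤ scaledWeight F (pairKeys d as)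
  | [], _ => by simp
  | a :: as, h => by
    have ih := mul_sum_le_scaledWeight (as := as) fun b hb => h b (by simp [hb])
    obtain ⟨ha, hc⟩ := h a (by simp)
    have hw : scaledWeight F (pairKeys d (a :: as)) =
        a * (5040 / d) * F (a, d) + (d - a) * (5040 / d) * F (d - a, d) +
          scaledWeight F (pairKeys d as) := by
      simp only [pairKeys, scaledWeight, List.flatMap_cons, List.cons_append, List.nil_append,
        List.map_cons, List.sum_cons]
      ring
    rw [hw, List.sum_cons]
    have hle : a * (5040 / d) * F (d - a, d) ≤ (d - a) * (5040 / d) * F (d - a, d) := by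
      gcongr
      omega
    calc c * ((a + as.sum) * (5040 / d))
        = a * (5040 / d) * (F (a, d) + F (d - a, d)) + c * (as.sum * (5040 / d)) := by
          rw [hc]; ring
      _ ≤ _ := by rw [mul_add]; omega

theorem entries_mem_typeSearch {F : ℕ × ℕ → ℕ} :
    ∀ {ds : List ℕ}, (∀ d ∈ ds, 0 < (lowUnits d).sum * (5040 / d)) →
      (∀ d ∈ ds, ∃ c, ∀ a ∈ lowUnits d, F (a, d) + F (d - a, d) = c) →
      entries F (fracKeys ds) ∈ typeSearch ds (scaledWeight F (fracKeys ds))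
  | [], _, _ => by
    have : scaledWeight F (fracKeys []) = F (1, 2) * 2520 := by
      simp [scaledWeight, fracKeys, mul_comm]
    rw [this, typeSearch, if_pos (Nat.mul_mod_left _ _), Nat.mul_div_cancel _ (by norm_num)]
    simp [entries, fracKeys]
  | d :: ds, hpos, h => by
    have ih := entries_mem_typeSearch (ds := ds) (fun e he => hpos e (by simp [he]))
      fun e he => h e (by simp [he])
    obtain ⟨c, hc⟩ := h d (by simp)
    have hkeys : fracKeys (d :: ds) = pairKeys d (lowUnits d) ++ fracKeys ds := by
      simp [fracKeys]
    rw [hkeys, entries_append, scaledWeight_append, typeSearch]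
    refine List.mem_flatMap.mpr ⟨c, ?_, entries_append_mem_pairSearch ih hc⟩
    rw [List.mem_range, Nat.lt_succ_iff, Nat.le_div_iff_mul_le (hpos d (by simp))]
    refine (mul_sum_le_scaledWeight fun a ha => ⟨?_, hc a ha⟩).trans (Nat.le_add_right _ _)
    simp only [lowUnits, List.mem_filter, decide_eq_true_eq] at ha
    exact ha.2.1

/-- The rational number named by a numerator-denominator pair. -/
def fracValue (k : ℕ × ℕ) : ℚ := k.1 / k.2

theorem fracValue_den {a d : ℕ} (ha : a < d) (h : a.Coprime d) : (fracValue (a, d)).den = d := by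
  have hd : 0 < d := by omega
  have := Rat.den_div_eq_of_coprime (a := (a : ℤ)) (b := (d : ℤ)) (by exact_mod_cast hd)
    (by simpa using h)
  simpa [fracValue] using this

theorem fracValue_num {a d : ℕ} (ha : a < d) (h : a.Coprime d) : (fracValue (a, d)).num = a := by
  have hd : 0 < d := by omega
  have := Rat.num_div_eq_of_coprime (a := (a : ℤ)) (b := (d : ℤ)) (by exact_mod_cast hd)
    (by simpa using h)
  simpa [fracValue] using this

theorem fracValue_nonneg (k : ℕ × ℕ) : 0 ≤ fracValue k := by unfold fracValue; positivity

theorem fracValue_lt_one {a d : ℕ} (h : a < d) : fracValue (a, d) < 1 := by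
  have : (0 : ℚ) < d := by exact_mod_cast (by omega : 0 < d)
  rw [fracValue, div_lt_one this]
  exact_mod_cast h

theorem exists_fracValue_eq {x : ℚ} (h0 : 0 ≤ x) (h1 : x < 1) :
    ∃ a, a < x.den ∧ a.Coprime x.den ∧ fracValue (a, x.den) = x := by
  have hn : 0 ≤ x.num := Rat.num_nonneg.mpr h0
  have hcast : ((x.num.toNat : ℕ) : ℤ) = x.num := Int.toNat_of_nonneg hn
  refine ⟨x.num.toNat, ?_, ?_, ?_⟩
  · have := Rat.num_lt_denom_iff.mpr h1
    omega
  · have := x.reduced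
    rwa [show x.num.natAbs = x.num.toNat by omega] at this
  · have : ((x.num.toNat : ℕ) : ℚ) = x.num := by exact_mod_cast hcast
    rw [fracValue, this, Rat.num_div_den]

theorem fract_neg_fracValue {a d : ℕ} (h0 : 0 < a) (h : a < d) :
    Int.fract (-fracValue (a, d)) = fracValue (d - a, d) := by
  rw [Int.fract_eq_iff]
  refine ⟨fracValue_nonneg _, fracValue_lt_one (by omega), -1, ?_⟩
  have : (d : ℚ) ≠ 0 := by exact_mod_cast (by omega : d ≠ 0)
  simp only [fracValue, Nat.cast_sub h.le]
  field_simp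
  push_cast
  ring

theorem IsAgeType.add_reflect_eq {f : ℚ →₀ ℕ} (hf : IsAgeType f) {a b d : ℕ}
    (ha0 : 0 < a) (ha : a < d) (had : a.Coprime d) (hb0 : 0 < b) (hb : b < d) (hbd : b.Coprime d) :
    f (fracValue (a, d)) + f (fracValue (d - a, d)) =
      f (fracValue (b, d)) + f (fracValue (d - b, d)) := by
  have := hf.2 _ _ (fracValue_nonneg (a, d)) (fracValue_lt_one ha) (fracValue_nonneg (b, d))
    (fracValue_lt_one hb) (by rw [fracValue_den ha had, fracValue_den hb hbd])
  rwa [fract_neg_fracValue ha0 ha, fract_neg_fracValue hb0 hb] at this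

theorem isAgeType_of_add_reflect_eq {f : ℚ →₀ ℕ} (hsupp : ∀ x ∈ f.support, 0 ≤ x ∧ x < 1)
    (h : ∀ d a, 0 < a → a < d → a.Coprime d → f (fracValue (a, d)) + f (fracValue (d - a, d)) =
      f (fracValue (1, d)) + f (fracValue (d - 1, d))) : IsAgeType f := by
  refine ⟨hsupp, fun x y hx0 hx1 hy0 hy1 hxy => ?_⟩
  obtain ⟨a, ha, had, hax⟩ := exists_fracValue_eq hx0 hx1
  obtain ⟨b, hb, hbd, hby⟩ := exists_fracValue_eq hy0 hy1
  rw [← hxy] at hb hbd hby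
  rw [← hax, ← hby]
  rcases Nat.eq_zero_or_pos a with rfl | ha0
  · have hd : x.den = 1 := by simpa using had
    have : b = 0 := by omega
    rw [this]
  rcases Nat.eq_zero_or_pos b with rfl | hb0
  · have hd : x.den = 1 := by simpa using hbd
    omega
  rw [fract_neg_fracValue ha0 ha, fract_neg_fracValue hb0 hb, h _ a ha0 ha had, h _ b hb0 hb hbd]

/-- A finite sum of terms of the weight of a type is at most its weight. -/
theorem IsAgeType.sum_le_typeWeight {f : ℚ →₀ ℕ} (hf : IsAgeType f) (s : Finset ℚ) :
    ∑ x ∈ s, x * f x ≤ typeWeight f := by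
  classical
  rw [typeWeight, ← Finset.sum_filter_of_ne (p := fun x => x ∈ f.support)]
  · refine Finset.sum_le_sum_of_subset_of_nonneg (by intro x; simp) fun x hx _ => ?_
    have := (hf.1 x hx).1
    positivity
  · intro x _ hx
    rw [Finsupp.mem_support_iff]
    rintro h
    simp [h] at hx

theorem fracValue_left_injective {d : ℕ} (hd : d ≠ 0) :
    Function.Injective fun a => fracValue (a, d) := by
  intro a b h
  have : (d : ℚ) ≠ 0 := by exact_mod_cast hd
  simpa [fracValue, div_left_inj' this] using h

/-- The fractions with denominator `d` contribute at least `(∑ a ∈ A, a) / d` to the weight, for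
any set `A` of numerators below `d / 2`, unless they all have value zero. -/
theorem IsAgeType.sum_le_mul_typeWeight {f : ℚ →₀ ℕ} (hf : IsAgeType f) {d : ℕ} {A : Finset ℕ}
    (hA : ∀ a ∈ A, 0 < a ∧ 2 * a < d ∧ a.Coprime d) {b : ℕ} (hb0 : 0 < b) (hb : b < d)
    (hbd : b.Coprime d) (hfb : f (fracValue (b, d)) ≠ 0) :
    ((∑ a ∈ A, a : ℕ) : ℚ) ≤ d * typeWeight f := by
  classical
  have hd : d ≠ 0 := by omega
  have hdq : (0 : ℚ) < d := by exact_mod_cast Nat.pos_of_ne_zero hd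
  have hinj : Set.InjOn (fun a => d - a) (A : Set ℕ) := by
    intro x hx y hy h
    have := hA x hx
    have := hA y hy
    simp only at h
    omega
  have hdisj : Disjoint A (A.image fun a => d - a) := by
    rw [Finset.disjoint_left]
    intro x hx hx'
    obtain ⟨y, hy, rfl⟩ := Finset.mem_image.mp hx'
    have := hA _ hx
    have := hA _ hy
    omega
  have key := hf.sum_le_typeWeight ((A ∪ A.image fun a => d - a).image fun a => fracValue (a, d))
  rw [Finset.sum_image ((fracValue_left_injective hd).injOn), Finset.sum_union hdisj,
    Finset.sum_image hinj, ← Finset.sum_add_distrib] at key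
  refine le_trans ?_ (mul_le_mul_of_nonneg_left key hdq.le)
  push_cast
  rw [Finset.mul_sum]
  refine Finset.sum_le_sum fun a ha => ?_
  obtain ⟨h0, h2, hc⟩ := hA a ha
  have hsum := hf.add_reflect_eq h0 (by omega) hc hb0 hb hbd
  have h1 : (1 : ℚ) ≤ f (fracValue (a, d)) + f (fracValue (d - a, d)) := by
    exact_mod_cast (by omega : 1 ≤ f (fracValue (a, d)) + f (fracValue (d - a, d)))
  have hle : (a : ℚ) ≤ d - a := by
    have : (2 * a : ℚ) < d := by exact_mod_cast h2
    linarith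
  have e1 : d * fracValue (a, d) = a := by simp only [fracValue]; field_simp
  have e2 : d * fracValue (d - a, d) = d - a := by
    simp only [fracValue, Nat.cast_sub (by omega : a ≤ d)]; field_simp
  rw [mul_add, ← mul_assoc, ← mul_assoc, e1, e2]
  have p1 : (0 : ℚ) ≤ a := by positivity
  have p2 : (0 : ℚ) ≤ f (fracValue (d - a, d)) := by positivity
  nlinarith [mul_le_mul_of_nonneg_right hle p2, mul_le_mul_of_nonneg_left h1 p1]

theorem Nat.coprime_of_linear_comb {a d : ℕ} (u v : ℤ) {n : ℕ} (h : u * a + v * d = n)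
    (hn : ∀ p : ℕ, p.Prime → p ∣ n → p ∣ a → ¬ p ∣ d) : a.Coprime d := by
  refine Nat.coprime_of_dvd fun p hp hpa hpd => ?_
  refine hn p hp ?_ hpa hpd
  have : (p : ℤ) ∣ n := by
    rw [← h]
    exact dvd_add ((Int.natCast_dvd_natCast.mpr hpa).mul_left _)
      ((Int.natCast_dvd_natCast.mpr hpd).mul_left _)
  exact_mod_cast this

theorem Nat.coprime_of_comb_eq_one {a d : ℕ} (u v : ℤ) (h : u * a + v * d = 1) :
    a.Coprime d :=
  Nat.coprime_of_linear_comb u v (n := 1) (by simpa using h) fun p hp h1 => by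
    exact absurd (Nat.dvd_one.mp h1) hp.one_lt.ne'

theorem Nat.coprime_of_comb_eq_two_pow {a d m : ℕ} (u v : ℤ) (h : u * a + v * d = (2 ^ m : ℕ))
    (hodd : a % 2 = 1 ∨ d % 2 = 1) : a.Coprime d :=
  Nat.coprime_of_linear_comb u v h fun p hp hdvd hpa hpd => by
    have := (Nat.prime_dvd_prime_iff_eq hp Nat.prime_two).mp (hp.dvd_of_dvd_pow hdvd)
    subst this
    omega

theorem Nat.coprime_of_comb_eq_three {a d : ℕ} (u v : ℤ) (h : u * a + v * d = 3)
    (hmod : a % 3 ≠ 0 ∨ d % 3 ≠ 0) : a.Coprime d :=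
  Nat.coprime_of_linear_comb u v (n := 3) (by simpa using h) fun p hp hdvd hpa hpd => by
    have := (Nat.prime_dvd_prime_iff_eq hp Nat.prime_three).mp hdvd
    subst this
    omega

theorem Nat.coprime_of_comb_eq_six {a d : ℕ} (u v : ℤ) (h : u * a + v * d = 6)
    (h2 : a % 2 ≠ 0 ∨ d % 2 ≠ 0) (h3 : a % 3 ≠ 0 ∨ d % 3 ≠ 0) : a.Coprime d :=
  Nat.coprime_of_linear_comb u v (n := 2 * 3) (by simpa using h) fun p hp hdvd hpa hpd => by
    rcases hp.dvd_mul.mp hdvd with h | h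
    · have := (Nat.prime_dvd_prime_iff_eq hp Nat.prime_two).mp h
      subst this
      omega
    · have := (Nat.prime_dvd_prime_iff_eq hp Nat.prime_three).mp h
      subst this
      omega

theorem exists_lowUnits_sum_gt_of_large {d : ℕ} (hd : 30 < d) :
    ∃ A : Finset ℕ, (∀ a ∈ A, 0 < a ∧ 2 * a < d ∧ a.Coprime d) ∧ d < ∑ a ∈ A, a := by
  have three : ∀ a b c : ℕ, a ≠ b → a ≠ c → b ≠ c → d < a + b + c →
      (0 < a ∧ 2 * a < d ∧ a.Coprime d) → (0 < b ∧ 2 * b < d ∧ b.Coprime d) →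
      (0 < c ∧ 2 * c < d ∧ c.Coprime d) →
      ∃ A : Finset ℕ, (∀ a ∈ A, 0 < a ∧ 2 * a < d ∧ a.Coprime d) ∧ d < ∑ a ∈ A, a := by
    intro a b c hab hac hbc hs ha hb hc
    refine ⟨{a, b, c}, by simpa only [Finset.forall_mem_insert, Finset.mem_singleton, forall_eq]
      using ⟨ha, hb, hc⟩, ?_⟩
    rw [Finset.sum_insert (by simp [hab, hac]), Finset.sum_pair hbc]
    omega
  have four : ∀ a b c e : ℕ, a ≠ b → a ≠ c → a ≠ e → b ≠ c → b ≠ e → c ≠ e → d < a + b + c + e →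
      (0 < a ∧ 2 * a < d ∧ a.Coprime d) → (0 < b ∧ 2 * b < d ∧ b.Coprime d) →
      (0 < c ∧ 2 * c < d ∧ c.Coprime d) → (0 < e ∧ 2 * e < d ∧ e.Coprime d) →
      ∃ A : Finset ℕ, (∀ a ∈ A, 0 < a ∧ 2 * a < d ∧ a.Coprime d) ∧ d < ∑ a ∈ A, a := by
    intro a b c e hab hac hae hbc hbe hce hs ha hb hc he
    refine ⟨{a, b, c, e}, by simpa only [Finset.forall_mem_insert, Finset.mem_singleton, forall_eq]
      using ⟨ha, hb, hc, he⟩, ?_⟩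
    rw [Finset.sum_insert (by simp [hab, hac, hae]), Finset.sum_insert (by simp [hbc, hbe]),
      Finset.sum_pair hce]
    omega
  rcases (by omega : d % 4 = 2 ∨ d % 4 = 0 ∨ d % 2 = 1) with h | h | h
  · obtain ⟨k, rfl⟩ : ∃ k, d = 2 * (2 * k + 1) := ⟨d / 4, by omega⟩
    refine three (2 * k - 1) (2 * k - 3) (2 * k - 7) (by omega) (by omega) (by omega) (by omega)
      ⟨by omega, by omega, Nat.coprime_of_comb_eq_two_pow (m := 2) (-2) 1 ?_ (by omega)⟩
      ⟨by omega, by omega, Nat.coprime_of_comb_eq_two_pow (m := 3) (-2) 1 ?_ (by omega)⟩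
      ⟨by omega, by omega, Nat.coprime_of_comb_eq_two_pow (m := 4) (-2) 1 ?_ (by omega)⟩ <;>
      push_cast <;> omega
  · rcases (by omega : d % 8 = 4 ∨ d % 16 = 8 ∨ d % 16 = 0) with h | h | h
    · obtain ⟨k, rfl⟩ : ∃ k, d = 4 * (2 * k + 1) := ⟨d / 8, by omega⟩
      refine four (4 * k + 1) (2 * k + 3) (2 * k - 1) (2 * k + 5)
        (by omega) (by omega) (by omega) (by omega) (by omega) (by omega) (by omega)
        ⟨by omega, by omega, Nat.coprime_of_comb_eq_two_pow (m := 1) (-2) 1 ?_ (by omega)⟩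
        ⟨by omega, by omega, Nat.coprime_of_comb_eq_two_pow (m := 3) 4 (-1) ?_ (by omega)⟩
        ⟨by omega, by omega, Nat.coprime_of_comb_eq_two_pow (m := 3) (-4) 1 ?_ (by omega)⟩
        ⟨by omega, by omega, Nat.coprime_of_comb_eq_two_pow (m := 4) 4 (-1) ?_ (by omega)⟩ <;>
        push_cast <;> omega
    · obtain ⟨k, rfl⟩ : ∃ k, d = 8 * (2 * k + 1) := ⟨d / 16, by omega⟩
      refine four (8 * k + 3) (4 * k + 1) (4 * k + 3) (2 * k + 3)
        (by omega) (by omega) (by omega) (by omega) (by omega) (by omega) (by omega)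
        ⟨by omega, by omega, Nat.coprime_of_comb_eq_two_pow (m := 1) (-2) 1 ?_ (by omega)⟩
        ⟨by omega, by omega, Nat.coprime_of_comb_eq_two_pow (m := 2) (-4) 1 ?_ (by omega)⟩
        ⟨by omega, by omega, Nat.coprime_of_comb_eq_two_pow (m := 2) 4 (-1) ?_ (by omega)⟩
        ⟨by omega, by omega, Nat.coprime_of_comb_eq_two_pow (m := 4) 8 (-1) ?_ (by omega)⟩ <;>
        push_cast <;> omega
    · obtain ⟨k, rfl⟩ : ∃ k, d = 8 * (2 * k) := ⟨d / 16, by omega⟩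
      refine four (8 * k - 1) (4 * k + 1) (4 * k - 1) (2 * k + 1)
        (by omega) (by omega) (by omega) (by omega) (by omega) (by omega) (by omega)
        ⟨by omega, by omega, Nat.coprime_of_comb_eq_two_pow (m := 1) (-2) 1 ?_ (by omega)⟩
        ⟨by omega, by omega, Nat.coprime_of_comb_eq_two_pow (m := 2) 4 (-1) ?_ (by omega)⟩
        ⟨by omega, by omega, Nat.coprime_of_comb_eq_two_pow (m := 2) (-4) 1 ?_ (by omega)⟩
        ⟨by omega, by omega, Nat.coprime_of_comb_eq_two_pow (m := 3) 8 (-1) ?_ (by omega)⟩ <;>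
        push_cast <;> omega
  · have half : 0 < (d - 1) / 2 ∧ 2 * ((d - 1) / 2) < d ∧ ((d - 1) / 2).Coprime d :=
      ⟨by omega, by omega, Nat.coprime_of_comb_eq_one (-2) 1 (by omega)⟩
    by_cases h3 : d % 3 = 0
    · obtain ⟨e, rfl⟩ : ∃ e, d = 3 * e := ⟨d / 3, by omega⟩
      rcases (by omega : e % 3 = 0 ∨ e % 3 = 1 ∨ e % 3 = 2) with he | he | he
      · refine three ((3 * e - 1) / 2) (e - 1) (e + 1) (by omega) (by omega) (by omega) (by omega)
          half
          ⟨by omega, by omega, Nat.coprime_of_comb_eq_three (-3) 1 ?_ (by omega)⟩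
          ⟨by omega, by omega, Nat.coprime_of_comb_eq_three 3 (-1) ?_ (by omega)⟩ <;>
          push_cast <;> omega
      · refine three ((3 * e - 1) / 2) (e + 1) (e - 2) (by omega) (by omega) (by omega) (by omega)
          half
          ⟨by omega, by omega, Nat.coprime_of_comb_eq_three 3 (-1) ?_ (by omega)⟩
          ⟨by omega, by omega, Nat.coprime_of_comb_eq_six (-3) 1 ?_ (by omega) (by omega)⟩ <;>
          push_cast <;> omega
      · refine three ((3 * e - 1) / 2) (e - 1) (e + 2) (by omega) (by omega) (by omega) (by omega)
          half
          ⟨by omega, by omega, Nat.coprime_of_comb_eq_three (-3) 1 ?_ (by omega)⟩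
          ⟨by omega, by omega, Nat.coprime_of_comb_eq_six 3 (-1) ?_ (by omega) (by omega)⟩ <;>
          push_cast <;> omega
    · rcases (by omega : d % 4 = 1 ∨ d % 4 = 3) with h4 | h4
      · refine three ((d - 1) / 2) ((d - 3) / 2) ((d - 1) / 4) (by omega) (by omega) (by omega)
          (by omega) half
          ⟨by omega, by omega, Nat.coprime_of_comb_eq_three (-2) 1 ?_ (by omega)⟩
          ⟨by omega, by omega, Nat.coprime_of_comb_eq_one (-4) 1 ?_⟩ <;> omega
      · refine three ((d - 1) / 2) ((d - 3) / 2) ((d + 1) / 4) (by omega) (by omega) (by omega)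
          (by omega) half
          ⟨by omega, by omega, Nat.coprime_of_comb_eq_three (-2) 1 ?_ (by omega)⟩
          ⟨by omega, by omega, Nat.coprime_of_comb_eq_one 4 (-1) ?_⟩ <;> omega

theorem exists_lowUnits_sum_gt {d : ℕ} (hd : 2 < d) (hs : d ∉ smallDens) :
    ∃ A : Finset ℕ, (∀ a ∈ A, 0 < a ∧ 2 * a < d ∧ a.Coprime d) ∧ d < ∑ a ∈ A, a := by
  by_cases h : 30 < d
  · exact exists_lowUnits_sum_gt_of_large h
  · refine ⟨(Finset.range d).filter fun a => 0 < a ∧ 2 * a < d ∧ a.Coprime d, by simp, ?_⟩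
    have key : ∀ d < 31, 2 < d → d ∉ smallDens →
        d < ∑ a ∈ (Finset.range d).filter (fun a => 0 < a ∧ 2 * a < d ∧ a.Coprime d), a := by
      decide +kernel
    exact key d (by omega) hd hs

theorem IsAgeType.apply_fracValue_eq_zero {f : ℚ →₀ ℕ} (hf : IsAgeType f) (hw : typeWeight f = 1)
    {a d : ℕ} (ha0 : 0 < a) (ha : a < d) (had : a.Coprime d) (hd : 2 < d) (hs : d ∉ smallDens) :
    f (fracValue (a, d)) = 0 := by
  by_contra hne
  obtain ⟨A, hA, hlt⟩ := exists_lowUnits_sum_gt hd hs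
  have := hf.sum_le_mul_typeWeight hA ha0 ha had hne
  rw [hw, mul_one] at this
  exact absurd (Nat.cast_le.mp this) hlt.not_ge

theorem fracKeys_smallDens_spec : ∀ k ∈ fracKeys smallDens,
    0 < k.1 ∧ k.1 < k.2 ∧ k.1.Coprime k.2 ∧ k.2 ∈ 2 :: smallDens ∧ 5040 / k.2 * k.2 = 5040 := by
  decide +kernel

theorem mem_fracKeys_smallDens {a d : ℕ} (hd : d ∈ 2 :: smallDens) (ha : a < d)
    (had : a.Coprime d) : (a, d) ∈ fracKeys smallDens := by
  have key : ∀ d ∈ 2 :: smallDens, ∀ a < d, a.Coprime d → (a, d) ∈ fracKeys smallDens := by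
    decide +kernel
  exact key d hd a ha had

theorem fracValue_key {k : ℕ × ℕ} (hk : k ∈ fracKeys smallDens) :
    ((fracValue k).num.toNat, (fracValue k).den) = k := by
  obtain ⟨_, hlt, hc, _⟩ := fracKeys_smallDens_spec k hk
  have h1 : (fracValue k).num = k.1 := fracValue_num hlt hc
  have h2 : (fracValue k).den = k.2 := fracValue_den hlt hc
  rw [h1, h2]
  rfl

theorem fracValue_injOn : Set.InjOn fracValue {k | k ∈ fracKeys smallDens} := by
  intro k hk l hl h
  rw [← fracValue_key hk, ← fracValue_key hl, h]

/-- The set of rational numbers at which a reduced type of weight one can be nonzero. -/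
def fracSupport : Finset ℚ := (fracKeys smallDens).toFinset.image fracValue

theorem mem_fracSupport {x : ℚ} : x ∈ fracSupport ↔ ∃ k ∈ fracKeys smallDens, fracValue k = x := by
  simp [fracSupport]

theorem typeWeight_mul_eq_scaledWeight {f : ℚ →₀ ℕ} (hf : f.support ⊆ fracSupport) :
    5040 * typeWeight f =
      (scaledWeight (fun k => f (fracValue k)) (fracKeys smallDens) : ℚ) := by
  have hnodup : (fracKeys smallDens).Nodup := by decide +kernel
  have h1 : typeWeight f = ∑ x ∈ fracSupport, x * f x :=
    Finset.sum_subset hf fun x _ hx => by simp [Finsupp.notMem_support_iff.mp hx]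
  rw [h1, fracSupport, Finset.sum_image (by simpa using fracValue_injOn), scaledWeight,
    ← List.sum_toFinset _ hnodup, Finset.mul_sum]
  push_cast
  refine Finset.sum_congr rfl fun k hk => ?_
  obtain ⟨h0, hlt, _, _, hdiv⟩ := fracKeys_smallDens_spec k (List.mem_toFinset.mp hk)
  have hk2 : (k.2 : ℚ) ≠ 0 := by exact_mod_cast (by omega : k.2 ≠ 0)
  have : ((5040 / k.2 : ℕ) : ℚ) = 5040 / k.2 := by
    rw [eq_div_iff hk2]
    exact_mod_cast hdiv
  rw [← mul_assoc, fracValue]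
  congr 1
  rw [this]
  ring

theorem support_subset_fracSupport {f : ℚ →₀ ℕ} (hf : IsAgeType f) (h0 : f 0 = 0)
    (hw : typeWeight f = 1) : f.support ⊆ fracSupport := by
  intro x hx
  have hx' := Finsupp.mem_support_iff.mp hx
  obtain ⟨a, ha, had, hax⟩ := exists_fracValue_eq (hf.1 x hx).1 (hf.1 x hx).2
  generalize x.den = d at *
  subst hax
  rcases Nat.eq_zero_or_pos a with rfl | ha0
  · exact absurd (by simpa [fracValue] using h0) hx'
  refine mem_fracSupport.mpr ⟨(a, d), mem_fracKeys_smallDens ?_ ha had, rfl⟩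
  by_contra hd
  rw [List.mem_cons, not_or] at hd
  exact hx' (hf.apply_fracValue_eq_zero hw ha0 ha had (by omega) hd.2)

/-- The finitely supported function with a given sparse table of values. -/
noncomputable def ofTable (l : List ((ℕ × ℕ) × ℕ)) : ℚ →₀ ℕ :=
  Finsupp.indicator fracSupport fun x _ => tableValue l (x.num.toNat, x.den)

theorem ofTable_support_subset (l : List ((ℕ × ℕ) × ℕ)) : (ofTable l).support ⊆ fracSupport :=
  Finsupp.support_indicator_subset _ _

theorem ofTable_fracValue (l : List ((ℕ × ℕ) × ℕ)) {k : ℕ × ℕ} (hk : k ∈ fracKeys smallDens) :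
    ofTable l (fracValue k) = tableValue l k := by
  rw [ofTable, Finsupp.indicator_of_mem (mem_fracSupport.mpr ⟨k, hk, rfl⟩), fracValue_key hk]

theorem ofTable_eq_zero (l : List ((ℕ × ℕ) × ℕ)) {x : ℚ} (hx : x ∉ fracSupport) :
    ofTable l x = 0 :=
  Finsupp.indicator_of_notMem hx _

theorem weightOneTables_spec : ∀ l ∈ weightOneTables,
    entries (tableValue l) (fracKeys smallDens) = l ∧
    scaledWeight (tableValue l) (fracKeys smallDens) = 5040 ∧
    ∀ d ∈ 2 :: smallDens, ∀ a < d, a.Coprime d →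
      tableValue l (a, d) + tableValue l (d - a, d) =
        tableValue l (1, d) + tableValue l (d - 1, d) := by
  decide +kernel

theorem weightOneTables_nodup : weightOneTables.Nodup := by decide +kernel

theorem weightOneTables_length : weightOneTables.length = 35 := by decide +kernel

theorem scaledWeight_congr {F G : ℕ × ℕ → ℕ} {ks : List (ℕ × ℕ)} (h : ∀ k ∈ ks, F k = G k) :
    scaledWeight F ks = scaledWeight G ks := by
  rw [scaledWeight, scaledWeight, List.map_congr_left fun k hk => by rw [h k hk]]

theorem entries_congr {F G : ℕ × ℕ → ℕ} {ks : List (ℕ × ℕ)} (h : ∀ k ∈ ks, F k = G k) :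
    entries F ks = entries G ks := by
  rw [entries, entries, List.flatMap_congr fun k hk => by rw [h k hk]]

theorem mem_entries {F : ℕ × ℕ → ℕ} {ks : List (ℕ × ℕ)} {k : ℕ × ℕ} {n : ℕ} :
    (k, n) ∈ entries F ks ↔ k ∈ ks ∧ F k = n ∧ n ≠ 0 := by
  simp only [entries, entry, List.mem_flatMap]
  constructor
  · rintro ⟨a, ha, h⟩
    split_ifs at h with h0
    · simp at h
    · simp only [List.mem_singleton, Prod.mk.injEq] at h
      obtain ⟨rfl, rfl⟩ := h
      exact ⟨ha, rfl, h0⟩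
  · rintro ⟨hk, rfl, hn⟩
    exact ⟨k, hk, by simp [hn]⟩

/-- The values on a list of keys are determined by the sparse table. -/
theorem eq_of_entries_eq {F G : ℕ × ℕ → ℕ} {ks : List (ℕ × ℕ)} (h : entries F ks = entries G ks)
    {k : ℕ × ℕ} (hk : k ∈ ks) : F k = G k := by
  by_cases hF : F k = 0
  · by_contra hG
    have : (k, G k) ∈ entries F ks := h ▸ mem_entries.mpr ⟨hk, rfl, fun h0 => hG (hF.trans h0.symm)⟩
    exact hG (mem_entries.mp this).2.1
  · have : (k, F k) ∈ entries G ks := h ▸ mem_entries.mpr ⟨hk, rfl, hF⟩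
    exact (mem_entries.mp this).2.1.symm

theorem zero_notMem_fracSupport : (0 : ℚ) ∉ fracSupport := by
  rw [mem_fracSupport]
  rintro ⟨k, hk, h⟩
  obtain ⟨h0, hlt, _⟩ := fracKeys_smallDens_spec k hk
  have h1 : (0 : ℚ) < k.1 := by exact_mod_cast h0
  have h2 : (0 : ℚ) < k.2 := by exact_mod_cast h0.trans hlt
  exact (div_pos h1 h2).ne' h

theorem isAgeType_ofTable {l : List ((ℕ × ℕ) × ℕ)} (hl : l ∈ weightOneTables) :
    IsAgeType (ofTable l) := by
  refine isAgeType_of_add_reflect_eq (fun x hx => ?_) fun d a ha0 ha had => ?_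
  · obtain ⟨⟨a, d⟩, hk, rfl⟩ := mem_fracSupport.mp (ofTable_support_subset l hx)
    exact ⟨fracValue_nonneg _, fracValue_lt_one (fracKeys_smallDens_spec _ hk).2.1⟩
  · have hd1 : 1 < d := by omega
    have had' : (d - a).Coprime d := (Nat.coprime_self_sub_left ha.le).mpr had
    have hone : (d - 1).Coprime d := (Nat.coprime_self_sub_left hd1.le).mpr (Nat.coprime_one_left d)
    by_cases hd : d ∈ 2 :: smallDens
    · rw [ofTable_fracValue l (mem_fracKeys_smallDens hd ha had),
        ofTable_fracValue l (mem_fracKeys_smallDens hd (by omega) had'),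
        ofTable_fracValue l (mem_fracKeys_smallDens hd hd1 (Nat.coprime_one_left d)),
        ofTable_fracValue l (mem_fracKeys_smallDens hd (by omega) hone)]
      exact (weightOneTables_spec l hl).2.2 d hd a ha had
    · have hzero : ∀ b < d, b.Coprime d → ofTable l (fracValue (b, d)) = 0 := by
        intro b hb hbd
        refine ofTable_eq_zero l fun hmem => hd ?_
        obtain ⟨k, hk, h⟩ := mem_fracSupport.mp hmem
        obtain ⟨_, hlt, hc, hk2, _⟩ := fracKeys_smallDens_spec k hk
        have h2 : (fracValue k).den = k.2 := fracValue_den hlt hc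
        rwa [← h2, h, fracValue_den hb hbd] at hk2
      rw [hzero a ha had, hzero _ (by omega) had', hzero 1 hd1 (Nat.coprime_one_left d),
        hzero _ (by omega) hone]

theorem typeWeight_ofTable {l : List ((ℕ × ℕ) × ℕ)} (hl : l ∈ weightOneTables) :
    typeWeight (ofTable l) = 1 := by
  have h := typeWeight_mul_eq_scaledWeight (ofTable_support_subset l)
  rw [scaledWeight_congr fun k hk => ofTable_fracValue l hk, (weightOneTables_spec l hl).2.1] at h
  push_cast at h
  linarith

theorem entries_ofTable {l : List ((ℕ × ℕ) × ℕ)} (hl : l ∈ weightOneTables) :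
    entries (fun k => ofTable l (fracValue k)) (fracKeys smallDens) = l :=
  (entries_congr fun _ hk => ofTable_fracValue l hk).trans (weightOneTables_spec l hl).1

theorem entries_mem_weightOneTables {f : ℚ →₀ ℕ} (hf : IsAgeType f) (h0 : f 0 = 0)
    (hw : typeWeight f = 1) :
    entries (fun k => f (fracValue k)) (fracKeys smallDens) ∈ weightOneTables := by
  have h := typeWeight_mul_eq_scaledWeight (support_subset_fracSupport hf h0 hw)
  have hs : scaledWeight (fun k => f (fracValue k)) (fracKeys smallDens) = 5040 := by
    rw [hw, mul_one] at h
    exact_mod_cast h.symm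
  have hmem := entries_mem_typeSearch (F := fun k => f (fracValue k)) (ds := smallDens)
    (by decide +kernel) fun d hd =>
      ⟨f (fracValue (1, d)) + f (fracValue (d - 1, d)), fun a ha => ?_⟩
  · rwa [hs] at hmem
  · have hd2 : 2 < d := (by decide : ∀ d ∈ smallDens, 2 < d) d hd
    simp only [lowUnits, List.mem_filter, List.mem_range, decide_eq_true_eq] at ha
    obtain ⟨had, _, hc⟩ := ha
    have ha0 : 0 < a := by
      rcases Nat.eq_zero_or_pos a with rfl | h
      · have : d = 1 := by simpa using hc
        omega
      · exact h
    exact hf.add_reflect_eq ha0 had hc one_pos (by omega) (Nat.coprime_one_left d)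

theorem setOf_reducedTypes_weight_one_eq_image :
    {f : ℚ →₀ ℕ | IsAgeType f ∧ f 0 = 0 ∧ typeWeight f = 1} =
      ofTable '' (weightOneTables.toFinset : Set (List ((ℕ × ℕ) × ℕ))) := by
  ext f
  simp only [Set.mem_ofPred_eq, Set.mem_image, List.coe_toFinset]
  constructor
  · rintro ⟨hf, h0, hw⟩
    have hmem := entries_mem_weightOneTables hf h0 hw
    refine ⟨_, hmem, Finsupp.ext fun x => ?_⟩
    by_cases hx : x ∈ fracSupport
    · obtain ⟨k, hk, rfl⟩ := mem_fracSupport.mp hx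
      exact eq_of_entries_eq (F := fun k => ofTable _ (fracValue k)) (G := fun k => f (fracValue k))
        (entries_ofTable hmem) hk
    · rw [ofTable_eq_zero _ hx, Finsupp.notMem_support_iff.mp fun h =>
        hx (support_subset_fracSupport hf h0 hw h)]
  · rintro ⟨l, hl, rfl⟩
    exact ⟨isAgeType_ofTable hl, ofTable_eq_zero l zero_notMem_fracSupport, typeWeight_ofTable hl⟩

theorem card_reducedTypes_weight_one :
    {f : ℚ →₀ ℕ | IsAgeType f ∧ f 0 = 0 ∧ typeWeight f = 1}.ncard = 35 := by
  rw [setOf_reducedTypes_weight_one_eq_image, Set.InjOn.ncard_image, Set.ncard_coe_finset,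
    List.toFinset_card_of_nodup weightOneTables_nodup, weightOneTables_length]
  intro l hl m hm h
  rw [List.coe_toFinset] at hl hm
  rw [← entries_ofTable hl, ← entries_ofTable hm, h]
end
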